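/- Let σ > -1, λ = d+1+σ, n a positive integer, 1 ≤ p < ∞, and equip the Bloch space with the seminorm ‖f‖_𝓑 = sup_{z∈B} (1-|z|²)^n (Σ_{|α|=n} |∂^α f(z)|^p)^{1/p}. Then ‖T_σ‖_{L^∞(B) → 𝓑} = C_p · Γ(λ+n)Γ(n) / Γ((λ+n)/2)², where C_p = max_{|ζ|=1} |Z(ζ)|_p satisfies: d̃^{1/p} d^{-n/2} ≤ C_p ≤ d̃^{1/p - 1/2} for 1 ≤ p < 2, and C_p = 1 for 2 ≤ p < ∞. -/

import Mathlib

open MeasureTheory Complex Metric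
open scoped ENNReal Classical

noncomputable section

abbrev Cd (d : ℕ) : Type := EuclideanSpace ℂ (Fin d)

instance (d : ℕ) : MeasurableSpace (Cd d) := borel _
instance (d : ℕ) : BorelSpace (Cd d) := ⟨rfl⟩
noncomputable instance (d : ℕ) : MeasureSpace (Cd d) := measureSpaceOfInnerProductSpace

/-- The open unit ball of `ℂ^d`. -/
def unitBall (d : ℕ) : Set (Cd d) := Metric.ball 0 1

/-- Lebesgue measure on `ℂ^d`, normalized so that the unit ball has measure one. -/
def normVol (d : ℕ) : Measure (Cd d) := (volume (unitBall d))⁻¹ • volume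

/-- The inner product `⟨z,w⟩ = ∑ z_j conj (w_j)`. -/
def herm {d : ℕ} (z w : Cd d) : ℂ := ∑ j, z j * (starRingEnd ℂ) (w j)

/-- The normalizing constant `c_σ`. -/
def cCoef (d : ℕ) (σ : ℝ) : ℝ :=
  Real.Gamma (d + σ + 1) / (Real.Gamma (σ + 1) * Real.Gamma (d + 1))

/-- The Bergman kernel `K_σ(z,w) = (1-|w|²)^σ / (1-⟨z,w⟩)^{d+1+σ}`. -/
def bergKer (d : ℕ) (σ : ℝ) (z w : Cd d) : ℂ :=
  (((1 - ‖w‖ ^ 2 : ℝ) ^ σ : ℝ) : ℂ) / (1 - herm z w) ^ ((((d : ℝ) + 1 + σ : ℝ)) : ℂ)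

/-- The Bergman projection `T_σ f (z) = c_σ ∫_B K_σ(z,w) f(w) dv(w)`. -/
def bergman (d : ℕ) (σ : ℝ) (f : Cd d → ℂ) (z : Cd d) : ℂ :=
  (cCoef d σ : ℂ) * ∫ w in unitBall d, bergKer d σ z w * f w ∂(normVol d)

/-- The complex partial derivative `∂/∂z_j`. -/
def pd (d : ℕ) (j : Fin d) (f : Cd d → ℂ) : Cd d → ℂ :=
  fun z => fderiv ℂ f z (EuclideanSpace.single j 1)

/-- The complex partial derivative `∂^α` for a multi-index `α`. -/
def mpd (d : ℕ) (α : Fin d → ℕ) (f : Cd d → ℂ) : Cd d → ℂ :=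
  (List.finRange d).foldr (fun j g => (pd d j)^[α j] g) f

/-- Multi-indices `α ∈ ℤ₊^d` with `|α| = n`; there are `d̃ = (n+d-1).choose (d-1)` of them. -/
def MIdx (d n : ℕ) : Type := {α : Fin d → ℕ // ∑ j, α j = n}

instance (d n : ℕ) : Fintype (MIdx d n) :=
  Fintype.subtype (Finset.Nat.antidiagonalTuple d n)
    (fun _ => Finset.Nat.mem_antidiagonalTuple)

/-- `𝒟_z f (z) = (∂^α f(z))_{|α|=n} ∈ ℂ^{d̃}`. -/
def Dmap (d n : ℕ) (f : Cd d → ℂ) (z : Cd d) : MIdx d n → ℂ := fun α => mpd d α.1 f z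

/-- `Z(ζ) = (ζ^α)_{|α|=n} ∈ ℂ^{d̃}`. -/
def Zmap (d n : ℕ) (ζ : Cd d) : MIdx d n → ℂ := fun α => ∏ j, ζ j ^ α.1 j

/-- The Bloch seminorm `‖f‖_𝓑 = sup_{z∈B} (1-|z|²)^n |𝒟_z f(z)|` w.r.t. a norm `N` on `ℂ^{d̃}`. -/
def blochSemi (d n : ℕ) (N : (MIdx d n → ℂ) → ℝ) (f : Cd d → ℂ) : ℝ :=
  ⨆ z : unitBall d, (1 - ‖(z : Cd d)‖ ^ 2) ^ n * N (Dmap d n f z)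

/-- The seminorm of `T_σ : L^∞(B) → 𝓑`, i.e. `sup_{‖G‖_∞ ≤ 1} ‖T_σ G‖_𝓑`. -/
def opSemi (d n : ℕ) (σ : ℝ) (N : (MIdx d n → ℂ) → ℝ) : ℝ :=
  ⨆ G : {G : Cd d → ℂ // Measurable G ∧ ∀ w, ‖G w‖ ≤ 1},
    blochSemi d n N (bergman d σ G.1)

/-- `𝓒 = max_{|ζ|=1} |Z(ζ)|`. -/
def maxC (d n : ℕ) (N : (MIdx d n → ℂ) → ℝ) : ℝ :=
  ⨆ ζ : Metric.sphere (0 : Cd d) 1, N (Zmap d n (ζ : Cd d))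

/-- The Möbius automorphism `φ_z` of the unit ball, with `φ_0 = -id`. -/
def moebius (d : ℕ) (z ω : Cd d) : Cd d :=
  if z = 0 then -ω
  else (1 - herm ω z)⁻¹ •
    (z - (herm ω z / ((‖z‖ ^ 2 : ℝ) : ℂ)) • z
       - ((Real.sqrt (1 - ‖z‖ ^ 2) : ℝ) : ℂ) • (ω - (herm ω z / ((‖z‖ ^ 2 : ℝ) : ℂ)) • z))

end

lemma finrank_Cd (d : ℕ) : Module.finrank ℝ (Cd d) = 2 * d := by
  rw [finrank_real_of_complex]; simp

lemma polar_hom (d : ℕ) (hd : 0 < d) (F : Cd d → ℝ) (m : ℕ)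
    (hF : ∀ (r : ℝ) (x : Cd d), 0 < r → F (r • x) = r ^ m * F x) (g : ℝ → ℝ) :
    ∫ w : Cd d, F w * g ‖w‖ =
      (∫ x : sphere (0 : Cd d) 1, F x ∂(volume : Measure (Cd d)).toSphere) *
        ∫ r in Set.Ioi (0 : ℝ), r ^ (2 * d - 1) * (r ^ m * g r) := by
  have : Nonempty (Fin d) := ⟨⟨0, hd⟩⟩
  set μ := (volume : Measure (Cd d)) with hμ
  calc
    ∫ w : Cd d, F w * g ‖w‖ ∂μ =
      ∫ x : ({(0)}ᶜ : Set (Cd d)), F x.1 * g (‖x.1‖) ∂(μ.comap (↑)) := by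
      rw [integral_subtype_comap (measurableSet_singleton _).compl fun x : Cd d ↦ F x * g (‖x‖),
        restrict_compl_singleton]
    _ = ∫ x, F x.1 * (x.2.1 ^ m * g x.2.1)
          ∂μ.toSphere.prod (.volumeIoiPow (Module.finrank ℝ (Cd d) - 1)) := by
      rw [← μ.measurePreserving_homeomorphUnitSphereProd.integral_comp
        (Homeomorph.measurableEmbedding _)]
      apply integral_congr_ae
      refine Filter.Eventually.of_forall fun x => ?_
      have hx : 0 < ‖x.1‖ := norm_pos_iff.2 x.2
      simp only [homeomorphUnitSphereProd_apply_snd_coe, homeomorphUnitSphereProd_apply_fst_coe]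
      have h1 : x.1 = ‖x.1‖ • (‖x.1‖⁻¹ • x.1) := by
        rw [smul_smul, mul_inv_cancel₀ hx.ne', one_smul]
      conv_lhs => rw [h1]
      rw [hF _ _ hx, ← h1]; ring
    _ = (∫ x : sphere (0 : Cd d) 1, F x ∂μ.toSphere) *
        ∫ x : Set.Ioi (0 : ℝ), (x.1 ^ m * g x.1) ∂.volumeIoiPow (Module.finrank ℝ (Cd d) - 1) :=
      integral_prod_mul (μ := μ.toSphere)
        (ν := Measure.volumeIoiPow (Module.finrank ℝ (Cd d) - 1))
        (fun x : sphere (0 : Cd d) 1 => F x)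
        (fun x : Set.Ioi (0 : ℝ) => x.1 ^ m * g x.1)
    _ = _ := by
      rw [finrank_Cd]
      simp only [Measure.volumeIoiPow, ENNReal.ofReal]
      rw [integral_withDensity_eq_integral_smul,
        integral_subtype_comap measurableSet_Ioi
          fun a : ℝ ↦ Real.toNNReal (a ^ (2 * d - 1)) • (a ^ m * g a),
        setIntegral_congr_fun measurableSet_Ioi fun x hx ↦ ?_]
      · rw [NNReal.smul_def, Real.coe_toNNReal _ (pow_nonneg hx.out.le _), smul_eq_mul]
      · exact (measurable_subtype_coe.pow_const _).real_toNNReal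

lemma beta_int {α β : ℝ} (hα : 0 < α) (hβ : 0 < β) :
    ∫ x in Set.Ioo (0 : ℝ) 1, x ^ (α - 1) * (1 - x) ^ (β - 1) =
      Real.Gamma α * Real.Gamma β / Real.Gamma (α + β) := by
  change _ = ProbabilityTheory.beta α β
  rw [ProbabilityTheory.beta_eq_betaIntegralReal α β hα hβ,
      betaIntegral, intervalIntegral.integral_of_le (by norm_num),
      ← integral_Ioc_eq_integral_Ioo, ← RCLike.re_to_complex, ← integral_re]
  · refine setIntegral_congr_fun measurableSet_Ioc fun x ⟨hx1, hx₂⟩ ↦ ?_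
    norm_cast
    rw [← Complex.ofReal_cpow, ← Complex.ofReal_cpow, RCLike.re_to_complex,
        Complex.re_mul_ofReal, Complex.ofReal_re]
    all_goals linarith
  convert! betaIntegral_convergent (u := α) (v := β) (by simpa) (by simpa)
  rw [intervalIntegrable_iff_integrableOn_Ioc_of_le (by simp), IntegrableOn]

/-- radial weight -/
noncomputable def radW (σ : ℝ) (r : ℝ) : ℝ := if r < 1 then (1 - r ^ 2) ^ σ else 0

lemma rad_int (d k : ℕ) (hd : 0 < d) {σ : ℝ} (hσ : -1 < σ) :
    ∫ r in Set.Ioi (0 : ℝ), r ^ (2 * d - 1) * (r ^ (2 * k) * radW σ r) =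
      Real.Gamma (d + k) * Real.Gamma (σ + 1) / (2 * Real.Gamma (d + k + σ + 1)) := by
  have h0 := integral_comp_rpow_Ioi
    (fun y : ℝ => (1 / 2 : ℝ) * (if y < 1 then y ^ ((d + k : ℝ) - 1) * (1 - y) ^ (σ + 1 - 1) else 0))
    (two_ne_zero)
  have h1 : ∫ r in Set.Ioi (0 : ℝ), r ^ (2 * d - 1) * (r ^ (2 * k) * radW σ r) =
     ∫ x in Set.Ioi (0:ℝ), (|(2:ℝ)| * x ^ ((2:ℝ) - 1)) • ((1 / 2 : ℝ) * (if x ^ (2:ℝ) < 1 then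
      (x ^ (2:ℝ)) ^ ((d + k : ℝ) - 1) * (1 - x ^ (2:ℝ)) ^ (σ + 1 - 1) else 0)) := by
    refine setIntegral_congr_fun measurableSet_Ioi fun x hx => ?_
    have hx : 0 < x := hx
    simp only [radW, add_sub_cancel_right, smul_eq_mul]
    rw [Real.rpow_two]
    by_cases h : x < 1
    · have h' : x ^ 2 < 1 := by nlinarith
      rw [if_pos h, if_pos h', ← Real.rpow_two x, ← Real.rpow_mul hx.le]
      have : x ^ (2 * d - 1) * x ^ (2 * k) = x ^ ((2:ℝ) - 1) * x ^ (2 * ((d + k : ℝ) - 1)) := by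
        rw [← Real.rpow_natCast, ← Real.rpow_natCast, ← Real.rpow_add hx, ← Real.rpow_add hx]
        congr 1
        rw [Nat.cast_sub (by omega)]; push_cast; ring
      rw [abs_of_pos two_pos, ← mul_assoc, this]; ring
    · have h' : ¬ x ^ 2 < 1 := by nlinarith
      rw [if_neg h, if_neg h']; simp
  rw [h1, h0, integral_const_mul]
  have h2 : ∫ y in Set.Ioi (0:ℝ), (if y < 1 then y ^ ((d + k : ℝ) - 1) * (1 - y) ^ (σ + 1 - 1) else 0)
     = ∫ y in Set.Ioo (0:ℝ) 1, y ^ ((d + k : ℝ) - 1) * (1 - y) ^ (σ + 1 - 1) := by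
    rw [← integral_indicator measurableSet_Ioi, ← integral_indicator measurableSet_Ioo]
    congr 1; ext y
    simp only [Set.indicator, Set.mem_Ioi, Set.mem_Ioo]
    by_cases h : 0 < y <;> by_cases h' : y < 1 <;> simp [h, h']
  have hd' : (0:ℝ) < d := by exact_mod_cast hd
  rw [h2, beta_int (by positivity) (by linarith), ← add_assoc]
  field_simp

lemma gauss_rad (d k : ℕ) (hd : 0 < d) :
    ∫ r in Set.Ioi (0 : ℝ), r ^ (2 * d - 1) * (r ^ (2 * k) * Real.exp (-r ^ 2)) =
      Real.Gamma (d + k) / 2 := by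
  have h := integral_rpow_mul_exp_neg_rpow (p := 2) (q := 2 * (d + k : ℝ) - 1) two_pos
    (by have : (0:ℝ) < d := by exact_mod_cast hd
        have : (0:ℝ) ≤ k := by positivity
        linarith)
  rw [show (2 * (d + k : ℝ) - 1 + 1) / 2 = d + k by ring] at h
  rw [show Real.Gamma (d + k) / 2 = 1 / 2 * Real.Gamma (d + k) by ring, ← h]
  refine setIntegral_congr_fun measurableSet_Ioi fun x hx => ?_
  have hx : 0 < x := hx
  rw [Real.rpow_two, ← mul_assoc]
  congr 1
  rw [← Real.rpow_natCast, ← Real.rpow_natCast, ← Real.rpow_add hx]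
  congr 1
  rw [Nat.cast_sub (by omega)]; push_cast; ring

lemma herm_eq_inner {d : ℕ} (z w : Cd d) : herm z w = inner ℂ w z := by
  simp [herm, PiLp.inner_apply]

/-- Gaussian moments -/
lemma gauss_moment (d : ℕ) (e : Cd d) (he : ‖e‖ = 1) : ∃ C : ℝ, C ≠ 0 ∧ ∀ k : ℕ,
    ∫ w : Cd d, ‖herm e w‖ ^ (2 * k) * Real.exp (-‖w‖ ^ 2) = C * (k.factorial : ℝ) := by
  have hd : 0 < d := by
    rcases Nat.eq_zero_or_pos d with h | h
    · subst h
      exfalso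
      rw [Subsingleton.elim e 0] at he; simp at he
    · exact h
  let i0 : Fin d := ⟨0, hd⟩
  obtain ⟨b, hb⟩ := Orthonormal.exists_orthonormalBasis_extension_of_card_eq (𝕜 := ℂ) (E := Cd d)
    (ι := Fin d) (by simp) (v := fun _ => e) (s := {i0}) (by
      constructor
      · rintro ⟨i, hi⟩; simpa using he
      · rintro ⟨i, hi⟩ ⟨j, hj⟩ h
        exact absurd (Subtype.ext (by simp at hi hj; simp [hi, hj])) h)
  have hb0 : b i0 = e := hb i0 (by simp)
  let L0 : Cd d ≃L[ℂ] (Fin d → ℂ) := b.repr.toContinuousLinearEquiv.trans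
      (PiLp.continuousLinearEquiv 2 ℂ (fun _ : Fin d => ℂ))
  let L : Cd d ≃L[ℝ] (Fin d → ℂ) :=
    (L0.toLinearEquiv.restrictScalars ℝ).toContinuousLinearEquiv
  have hL : ∀ w i, L w i = b.repr w i := fun w i => rfl
  have hH : (Measure.map L (volume : Measure (Cd d))).IsAddHaarMeasure :=
    L.isAddHaarMeasure_map _
  obtain ⟨c, hc0, hc⟩ : ∃ c : ENNReal, (c ≠ 0 ∧ c ≠ ⊤) ∧
      Measure.map L (volume : Measure (Cd d)) = c • (volume : Measure (Fin d → ℂ)) := by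
    refine ⟨_, ⟨?_, ?_⟩, Measure.isAddLeftInvariant_eq_smul _ _⟩
    · exact_mod_cast (Measure.addHaarScalarFactor_pos_of_isAddHaarMeasure _ _).ne'
    · exact ENNReal.coe_ne_top
  refine ⟨c.toReal * Real.pi ^ d, mul_ne_zero (ENNReal.toReal_ne_zero.2 hc0) (by positivity), ?_⟩
  intro k
  let f : Fin d → ℂ → ℝ := fun i u => (if i = i0 then ‖u‖ ^ (2 * k) else 1) * Real.exp (-‖u‖ ^ 2)
  have h1 : ∀ w : Cd d, ‖herm e w‖ ^ (2 * k) * Real.exp (-‖w‖ ^ 2) = ∏ i, f i (L w i) := by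
    intro w
    simp only [f]
    rw [Finset.prod_mul_distrib, ← Real.exp_sum, Finset.prod_ite_eq' Finset.univ i0 (fun x => ‖L w x‖ ^ (2*k))]
    simp only [Finset.mem_univ, if_true, hL]
    rw [Finset.sum_neg_distrib, ← EuclideanSpace.norm_sq_eq, LinearIsometryEquiv.norm_map,
      b.repr_apply_apply, hb0, herm_eq_inner, norm_inner_symm]
  have h2 : ∫ w : Cd d, ‖herm e w‖ ^ (2 * k) * Real.exp (-‖w‖ ^ 2) =
      ∫ x, ∏ i, f i (x i) ∂(Measure.map L (volume : Measure (Cd d))) := by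
    have hme : MeasurableEmbedding L := L.toHomeomorph.measurableEmbedding
    rw [hme.integral_map]
    exact integral_congr_ae (Filter.Eventually.of_forall h1)
  have hm : ∀ j : ℕ, ∫ u : ℂ, ‖u‖ ^ (2 * j) * Real.exp (-‖u‖ ^ 2) = Real.pi * j.factorial := by
    intro j
    have := Complex.integral_rpow_mul_exp_neg_rpow (p := 2) (q := 2 * j) (by norm_num)
      (by have : (0:ℝ) ≤ j := by positivity
          linarith)
    rw [show (2 * (j:ℝ) + 2) / 2 = j + 1 by ring, Real.Gamma_nat_eq_factorial] at this
    rw [show Real.pi * j.factorial = 2 * Real.pi / 2 * j.factorial by ring, ← this]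
    congr 1; ext u
    rw [Real.rpow_two, ← Real.rpow_natCast]; push_cast; rfl
  have hm0 : ∫ u : ℂ, Real.exp (-‖u‖ ^ 2) = Real.pi := by simpa using hm 0
  rw [h2, hc, integral_smul_measure, integral_fintype_prod_volume_eq_prod]
  have h3 : ∀ i, ∫ u, f i u = Real.pi * (if i = i0 then (k.factorial : ℝ) else 1) := by
    intro i
    simp only [f]
    split_ifs
    · exact hm k
    · simpa using hm0
  simp_rw [h3]
  rw [Finset.prod_mul_distrib, Finset.prod_ite_eq']
  simp
  ring

/-- The weighted probability measure on the ball. -/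
noncomputable def wP (d : ℕ) (σ : ℝ) : Measure (Cd d) :=
  ((normVol d).restrict (unitBall d)).withDensity
    (fun w => ENNReal.ofReal (cCoef d σ * (1 - ‖w‖ ^ 2) ^ σ))

lemma cCoef_pos (d : ℕ) {σ : ℝ} (hσ : -1 < σ) : 0 < cCoef d σ := by
  have : (0:ℝ) ≤ d := by positivity
  unfold cCoef
  have h1 := Real.Gamma_pos_of_pos (show 0 < d + σ + 1 by linarith)
  have h2 := Real.Gamma_pos_of_pos (show 0 < σ + 1 by linarith)
  have h3 := Real.Gamma_pos_of_pos (show (0:ℝ) < d + 1 by linarith)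
  positivity

lemma measurableSet_unitBall (d : ℕ) : MeasurableSet (unitBall d) := measurableSet_ball

lemma mem_unitBall {d : ℕ} {w : Cd d} : w ∈ unitBall d ↔ ‖w‖ < 1 := by
  simp [unitBall]

lemma measurable_dens (d : ℕ) (σ : ℝ) :
    Measurable (fun w : Cd d => cCoef d σ * (1 - ‖w‖ ^ 2) ^ σ) := by
  have : Measurable (fun r : ℝ => cCoef d σ * (1 - r ^ 2) ^ σ) := by fun_prop
  exact this.comp measurable_norm

lemma one_sub_sq_nonneg {d : ℕ} {w : Cd d} (h : w ∈ unitBall d) : 0 < 1 - ‖w‖ ^ 2 := by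
  have := mem_unitBall.1 h
  nlinarith [norm_nonneg w]

lemma integral_wP (d : ℕ) {σ : ℝ} (hσ : -1 < σ) {E : Type*} [NormedAddCommGroup E]
    [NormedSpace ℝ E] (F : Cd d → E) :
    ∫ w, F w ∂(wP d σ) =
      ∫ w in unitBall d, (cCoef d σ * (1 - ‖w‖ ^ 2) ^ σ) • F w ∂(normVol d) := by
  unfold wP
  rw [integral_withDensity_eq_integral_toReal_smul (measurable_dens d σ).ennreal_ofReal
    (Filter.Eventually.of_forall fun _ => ENNReal.ofReal_lt_top)]
  refine setIntegral_congr_fun (measurableSet_unitBall d) fun w hw => ?_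
  rw [ENNReal.toReal_ofReal]
  have := cCoef_pos d hσ
  have := one_sub_sq_nonneg hw
  positivity

lemma integral_wP' (d : ℕ) {σ : ℝ} (hσ : -1 < σ) {E : Type*} [NormedAddCommGroup E]
    [NormedSpace ℝ E] (F : Cd d → E) :
    ∫ w, F w ∂(wP d σ) =
      ((volume (unitBall d)).toReal⁻¹ * cCoef d σ) • ∫ w, radW σ ‖w‖ • F w := by
  rw [integral_wP d hσ, normVol, Measure.restrict_smul, integral_smul_measure, mul_smul,
    ENNReal.toReal_inv, ← integral_smul (cCoef d σ), ← integral_indicator (measurableSet_unitBall d)]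
  congr 1
  refine integral_congr_ae (Filter.Eventually.of_forall fun w => ?_)
  by_cases h : ‖w‖ < 1
  · simp only
    rw [Set.indicator_of_mem (mem_unitBall.2 h)]
    simp [radW, h, mul_smul]
  · simp only
    rw [Set.indicator_of_notMem (fun h' => h (mem_unitBall.1 h'))]
    simp [radW, h]

lemma rot_wP (d : ℕ) {σ : ℝ} (hσ : -1 < σ) (t : ℂ) (ht : ‖t‖ = 1) {E : Type*}
    [NormedAddCommGroup E] [NormedSpace ℝ E] (F : Cd d → E) :
    ∫ w, F (t • w) ∂(wP d σ) = ∫ w, F w ∂(wP d σ) := by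
  rw [integral_wP' d hσ, integral_wP' d hσ]
  congr 1
  have ht0 : t ≠ 0 := by rintro rfl; simp at ht
  let U : Cd d ≃ₗᵢ[ℝ] Cd d :=
    { toLinearEquiv := (LinearEquiv.smulOfNeZero ℂ (Cd d) t ht0).restrictScalars ℝ
      norm_map' := fun w => by
        change ‖t • w‖ = ‖w‖
        rw [norm_smul, ht, one_mul] }
  have hU : ∀ w, U w = t • w := fun w => rfl
  rw [← U.measurePreserving.integral_comp U.toHomeomorph.measurableEmbedding
    (fun w => radW σ ‖w‖ • F w)]
  simp only [hU, norm_smul, ht, one_mul]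

lemma moment_wP (d : ℕ) {σ : ℝ} (hσ : -1 < σ) (e : Cd d) (he : ‖e‖ = 1) (k : ℕ) :
    ∫ w, ‖herm e w‖ ^ (2 * k) ∂(wP d σ) =
      k.factorial * Real.Gamma (d + 1 + σ) / Real.Gamma (d + 1 + σ + k) := by
  have hd : 0 < d := by
    rcases Nat.eq_zero_or_pos d with h | h
    · subst h
      exfalso
      rw [Subsingleton.elim e 0] at he; simp at he
    · exact h
  have hd' : (0:ℝ) < d := by exact_mod_cast hd
  have hk : (0:ℝ) ≤ k := by positivity
  have hom : ∀ k : ℕ, ∀ (r : ℝ) (x : Cd d), 0 < r →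
      ‖herm e (r • x)‖ ^ (2 * k) = r ^ (2 * k) * ‖herm e x‖ ^ (2 * k) := by
    intro k r x hr
    rw [herm_eq_inner, herm_eq_inner, ← Complex.coe_smul, inner_smul_left, norm_mul, mul_pow]
    simp [abs_of_pos hr]
  set S : ℕ → ℝ := fun k =>
    ∫ x : sphere (0 : Cd d) 1, ‖herm e x‖ ^ (2 * k) ∂(volume : Measure (Cd d)).toSphere with hS
  have hP : ∀ (k : ℕ) (g : ℝ → ℝ), ∫ w : Cd d, ‖herm e w‖ ^ (2 * k) * g ‖w‖ =
      S k * ∫ r in Set.Ioi (0 : ℝ), r ^ (2 * d - 1) * (r ^ (2 * k) * g r) :=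
    fun k g => polar_hom d hd _ (2 * k) (hom k) g
  obtain ⟨C, hC0, hC⟩ := gauss_moment d e he
  have hG : ∀ k : ℕ, S k * (Real.Gamma (d + k) / 2) = C * k.factorial := by
    intro k
    rw [← hC, ← gauss_rad d k hd]
    exact (hP k (fun r => Real.exp (-r ^ 2))).symm
  have hB : ∀ (k : ℕ) (τ : ℝ), -1 < τ → ∫ w : Cd d, ‖herm e w‖ ^ (2 * k) * radW τ ‖w‖ =
      S k * (Real.Gamma (d + k) * Real.Gamma (τ + 1) / (2 * Real.Gamma (d + k + τ + 1))) := by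
    intro k τ hτ
    rw [hP, rad_int d k hd hτ]
  have hvol : (volume (unitBall d)).toReal = S 0 * (Real.Gamma d / (2 * Real.Gamma (d + 1))) := by
    have h := hB 0 0 (by norm_num)
    simp only [mul_zero, pow_zero, one_mul, Nat.cast_zero, add_zero, zero_add, Real.Gamma_one,
      mul_one] at h
    rw [← h]
    have : (fun w : Cd d => radW 0 ‖w‖) = (unitBall d).indicator (fun _ => (1:ℝ)) := by
      ext w
      by_cases h : ‖w‖ < 1
      · rw [Set.indicator_of_mem (mem_unitBall.2 h)]
        simp [radW, h]
      · rw [Set.indicator_of_notMem (fun h' => h (mem_unitBall.1 h'))]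
        simp [radW, h]
    rw [this, integral_indicator (measurableSet_unitBall d)]
    simp [Measure.real]
  rw [integral_wP' d hσ]
  simp only [smul_eq_mul]
  simp_rw [mul_comm (radW σ _)]
  rw [hB k σ hσ, hvol]
  have g1 := Real.Gamma_pos_of_pos hd'
  have g2 := Real.Gamma_pos_of_pos (show 0 < (d:ℝ) + k by linarith)
  have g3 := Real.Gamma_pos_of_pos (show 0 < (d:ℝ) + 1 by linarith)
  have g4 := Real.Gamma_pos_of_pos (show 0 < σ + 1 by linarith)
  have g5 := Real.Gamma_pos_of_pos (show 0 < (d:ℝ) + 1 + σ by linarith)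
  have g6 := Real.Gamma_pos_of_pos (show 0 < (d:ℝ) + 1 + σ + k by linarith)
  have e0 : S 0 = 2 * C / Real.Gamma d := by
    have := hG 0
    simp only [Nat.cast_zero, add_zero, Nat.factorial_zero, Nat.cast_one, mul_one] at this
    field_simp; linarith
  have e1 : S k = 2 * C * k.factorial / Real.Gamma (d + k) := by
    have := hG k
    field_simp; linarith
  rw [e0, e1, cCoef, show (d:ℝ) + k + σ + 1 = d + 1 + σ + k by ring,
    show (d:ℝ) + σ + 1 = d + 1 + σ by ring]
  field_simp

lemma exists_unit (d : ℕ) (hd : 0 < d) : ∃ e : Cd d, ‖e‖ = 1 :=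
  ⟨EuclideanSpace.single ⟨0, hd⟩ 1, by simp⟩

lemma isFinite_wP (d : ℕ) (hd : 0 < d) {σ : ℝ} (hσ : -1 < σ) : IsFiniteMeasure (wP d σ) := by
  obtain ⟨e, he⟩ := exists_unit d hd
  have h := moment_wP d hσ e he 0
  simp only [mul_zero, pow_zero, Nat.factorial_zero, Nat.cast_one, one_mul, Nat.cast_zero,
    add_zero] at h
  have hd' : (0:ℝ) < d := by exact_mod_cast hd
  rw [div_self (Real.Gamma_pos_of_pos (show 0 < (d:ℝ) + 1 + σ by linarith)).ne'] at h
  rw [integral_wP d hσ] at h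
  unfold wP
  apply isFiniteMeasure_withDensity_ofReal
  have h2 : Integrable (fun w : Cd d => (cCoef d σ * (1 - ‖w‖ ^ 2) ^ σ) • (1:ℝ))
      ((normVol d).restrict (unitBall d)) := Integrable.of_integral_ne_zero (by rw [h]; norm_num)
  simpa using h2.2

lemma ae_wP (d : ℕ) (σ : ℝ) : ∀ᵐ w ∂(wP d σ), w ∈ unitBall d :=
  (withDensity_absolutelyContinuous _ _).ae_le (ae_restrict_mem (measurableSet_unitBall d))

lemma bergman_eq (d : ℕ) {σ : ℝ} (hσ : -1 < σ) (f : Cd d → ℂ) (z : Cd d) :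
    bergman d σ f z = ∫ w, f w / (1 - herm z w) ^ (((d + 1 + σ : ℝ)) : ℂ) ∂(wP d σ) := by
  rw [integral_wP d hσ, bergman, ← integral_const_mul]
  congr 1; ext w
  simp only [bergKer, Complex.real_smul]
  push_cast; ring

lemma HasSum.congr_fun' {f g : ℕ → ℂ} {a : ℂ} (h : HasSum f a) (hfg : ∀ k, g k = f k) :
    HasSum g a := by
  rwa [show g = f from funext hfg]

/-- binomial coefficients -/
noncomputable def bc (a : ℝ) (k : ℕ) : ℝ := Real.Gamma (a + k) / (Real.Gamma a * k.factorial)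

lemma bc_pos {a : ℝ} (ha : 0 < a) (k : ℕ) : 0 < bc a k := by
  have h1 := Real.Gamma_pos_of_pos ha
  have h2 := Real.Gamma_pos_of_pos (show 0 < a + k by positivity)
  unfold bc; positivity

lemma asc_eval {a : ℝ} (ha : 0 < a) (k : ℕ) :
    (ascPochhammer ℂ k).eval (a : ℂ) = ((Real.Gamma (a + k) / Real.Gamma a : ℝ) : ℂ) := by
  have h1 := Real.Gamma_pos_of_pos ha
  induction k with
  | zero => simp [h1.ne']
  | succ k ih =>
    rw [ascPochhammer_succ_eval, ih]
    have h2 : a + k ≠ 0 := by positivity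
    rw [show a + ((k + 1 : ℕ) : ℝ) = (a + k) + 1 by push_cast; ring, Real.Gamma_add_one h2]
    push_cast; ring

lemma choose_bc {a : ℝ} (ha : 0 < a) (k : ℕ) :
    Ring.choose ((a : ℂ) + k - 1) k = ((bc a k : ℝ) : ℂ) := by
  have h := Ring.factorial_nsmul_multichoose_eq_ascPochhammer (a : ℂ) k
  rw [Polynomial.ascPochhammer_smeval_eq_eval, asc_eval ha, nsmul_eq_mul] at h
  have hk : (k.factorial : ℂ) ≠ 0 := by exact_mod_cast k.factorial_ne_zero
  rw [Ring.choose, show (a : ℂ) + k - 1 - k + 1 = a by ring]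
  rw [eq_comm, ← mul_right_inj' hk, h, bc]
  push_cast
  field_simp

lemma hasSum_bc {a : ℝ} (ha : 0 < a) {u : ℂ} (hu : ‖u‖ < 1) :
    HasSum (fun k => ((bc a k : ℝ) : ℂ) * u ^ k) (1 / (1 - u) ^ (a : ℂ)) := by
  have h := (one_div_one_sub_cpow_hasFPowerSeriesOnBall_zero (a : ℂ)).hasSum (y := u) (by
    simpa [enorm_eq_nnnorm] using (by exact_mod_cast hu : ‖u‖₊ < 1))
  simp only [FormalMultilinearSeries.ofScalars_apply_eq, zero_add, smul_eq_mul] at h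
  simpa [choose_bc ha] using h

lemma hasSum_bc_real {a : ℝ} (ha : 0 < a) {x : ℝ} (hx0 : 0 ≤ x) (hx : x < 1) :
    HasSum (fun k => bc a k * x ^ k) (1 / (1 - x) ^ a) := by
  have h := hasSum_bc ha (u := (x : ℂ)) (by simpa [abs_of_nonneg hx0] using hx)
  rw [← Complex.hasSum_ofReal]
  convert h using 1
  · ext k; push_cast; rfl
  · rw [Complex.ofReal_div, Complex.ofReal_cpow (by linarith)]; simp

lemma norm_herm_le {d : ℕ} (z w : Cd d) : ‖herm z w‖ ≤ ‖z‖ * ‖w‖ := by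
  rw [herm_eq_inner, mul_comm]; exact norm_inner_le_norm _ _

lemma norm_herm_le' {d : ℕ} (z : Cd d) {w : Cd d} (hw : w ∈ unitBall d) : ‖herm z w‖ ≤ ‖z‖ := by
  have := norm_herm_le z w
  have := mem_unitBall.1 hw
  nlinarith [norm_nonneg z]

lemma continuous_herm {d : ℕ} (z : Cd d) : Continuous (fun w : Cd d => herm z w) := by
  simp_rw [herm_eq_inner]; fun_prop

lemma offdiag (d : ℕ) {σ : ℝ} (hσ : -1 < σ) (z : Cd d) {j k : ℕ} (hjk : j ≠ k) :
    ∫ w, (herm z w) ^ j * (starRingEnd ℂ (herm z w)) ^ k ∂(wP d σ) = 0 := by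
  set A := ∫ w, (herm z w) ^ j * (starRingEnd ℂ (herm z w)) ^ k ∂(wP d σ) with hA
  set θ : ℝ := Real.pi / ((k : ℝ) - j) with hθ
  have hne : ((k : ℝ) - j) ≠ 0 := by
    rw [sub_ne_zero]; exact_mod_cast hjk.symm
  set t : ℂ := Complex.exp (θ * I) with ht
  have hn : ‖t‖ = 1 := Complex.norm_exp_ofReal_mul_I θ
  have hconj : starRingEnd ℂ t = Complex.exp (-(θ * I)) := by
    rw [ht, ← Complex.exp_conj]; simp
  have h := rot_wP d hσ t hn (fun w => (herm z w) ^ j * (starRingEnd ℂ (herm z w)) ^ k)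
  have h1 : ∀ w : Cd d, herm z (t • w) = starRingEnd ℂ t * herm z w := by
    intro w; rw [herm_eq_inner, herm_eq_inner, inner_smul_left]
  have h2 : (starRingEnd ℂ t) ^ j * t ^ k = -1 := by
    rw [hconj, ht, ← Complex.exp_nat_mul, ← Complex.exp_nat_mul, ← Complex.exp_add]
    rw [show (j : ℂ) * -(θ * I) + k * (θ * I) = ((((k : ℝ) - j) * θ : ℝ) : ℂ) * I by
      push_cast; ring]
    rw [hθ, mul_div_cancel₀ _ hne, Complex.exp_pi_mul_I]
  have h3 : ∀ w : Cd d, (herm z (t • w)) ^ j * (starRingEnd ℂ (herm z (t • w))) ^ k =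
      (-1) * ((herm z w) ^ j * (starRingEnd ℂ (herm z w)) ^ k) := by
    intro w
    rw [h1, ← h2]
    simp only [map_mul, Complex.conj_conj]; ring
  simp only [h3] at h
  rw [integral_const_mul, ← hA] at h
  have : (2 : ℂ) * A = 0 := by linear_combination -h
  simpa using this

lemma one_sub_ne {u : ℂ} (hu : ‖u‖ < 1) : 1 - u ≠ 0 := by
  intro h
  have : u = 1 := by linear_combination -h
  rw [this] at hu; simp at hu

lemma hasSum_hyp (d : ℕ) {σ : ℝ} (hσ : -1 < σ) (e : Cd d) (he : ‖e‖ = 1) {r : ℝ} (hr0 : 0 ≤ r)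
    (hr : r < 1) {a : ℝ} (ha : 0 < a) :
    HasSum (fun k : ℕ => bc a k ^ 2 * (r ^ 2) ^ k *
      (k.factorial * Real.Gamma (d + 1 + σ) / Real.Gamma (d + 1 + σ + k)))
      (∫ w, 1 / ‖1 - herm (r • e) w‖ ^ (2 * a) ∂(wP d σ)) := by
  have hd : 0 < d := by
    rcases Nat.eq_zero_or_pos d with h | h
    · subst h
      exfalso
      rw [Subsingleton.elim e 0] at he; simp at he
    · exact h
  have := isFinite_wP d hd hσ
  set z : Cd d := r • e with hz
  have hzn : ‖z‖ = r := by rw [hz, norm_smul, he]; simp [abs_of_nonneg hr0]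
  have hzw : ∀ w, herm z w = r * herm e w := by
    intro w; rw [herm_eq_inner, herm_eq_inner, hz, ← Complex.coe_smul, inner_smul_right]
  have hb := hasSum_bc_real ha hr0 hr
  have hb0 : ∀ k, 0 ≤ bc a k * r ^ k := fun k => mul_nonneg (bc_pos ha k).le (by positivity)
  have hbb : Summable (fun x : ℕ × ℕ => (bc a x.1 * r ^ x.1) * (bc a x.2 * r ^ x.2)) :=
    hb.summable.mul_of_nonneg hb.summable hb0 hb0
  have key := hasSum_integral_of_dominated_convergence (μ := wP d σ)
    (F := fun (x : ℕ × ℕ) w => (((bc a x.1 : ℝ) : ℂ) * (herm z w) ^ x.1) *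
      (((bc a x.2 : ℝ) : ℂ) * (starRingEnd ℂ (herm z w)) ^ x.2))
    (f := fun w => ((1 / ‖1 - herm z w‖ ^ (2 * a) : ℝ) : ℂ))
    (fun x _ => (bc a x.1 * r ^ x.1) * (bc a x.2 * r ^ x.2))
    (fun x => by
      have := continuous_herm z
      exact Continuous.aestronglyMeasurable (by fun_prop))
    (fun x => by
      filter_upwards [ae_wP d σ] with w hw
      have h1 := norm_herm_le' z hw
      rw [hzn] at h1
      simp only [norm_mul, norm_pow, Complex.norm_real, Real.norm_eq_abs, abs_of_pos (bc_pos ha _),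
        RCLike.norm_conj]
      have := (bc_pos ha x.1).le
      have := (bc_pos ha x.2).le
      gcongr)
    (Filter.Eventually.of_forall fun w => hbb)
    (integrable_const _)
    (by
      filter_upwards [ae_wP d σ] with w hw
      have h1 := norm_herm_le' z hw
      rw [hzn] at h1
      have h2 : ‖herm z w‖ < 1 := by linarith
      have s1 := hasSum_bc ha h2
      have s2 : HasSum (fun k => ((bc a k : ℝ) : ℂ) * (starRingEnd ℂ (herm z w)) ^ k)
          (starRingEnd ℂ (1 / (1 - herm z w) ^ (a : ℂ))) := by
        have := (Complex.hasSum_conj (f := fun k => ((bc a k : ℝ) : ℂ) * (herm z w) ^ k)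
          (x := starRingEnd ℂ (1 / (1 - herm z w) ^ (a : ℂ)))).2 (by simpa using s1)
        simpa using this
      have s3 := s1.mul s2 (by
        refine Summable.of_norm_bounded hbb fun x => ?_
        simp only [norm_mul, norm_pow, Complex.norm_real, Real.norm_eq_abs,
          abs_of_pos (bc_pos ha _), RCLike.norm_conj]
        have := (bc_pos ha x.1).le
        have := (bc_pos ha x.2).le
        gcongr)
      have e3 : ((1 / ‖1 - herm z w‖ ^ (2 * a) : ℝ) : ℂ) =
          1 / (1 - herm z w) ^ (a : ℂ) * (starRingEnd ℂ) (1 / (1 - herm z w) ^ (a : ℂ)) := by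
        rw [Complex.mul_conj, Complex.normSq_eq_norm_sq]
        congr 1
        rw [norm_div, norm_one, Complex.norm_cpow_real, div_pow, one_pow, ← Real.rpow_natCast,
          ← Real.rpow_mul (norm_nonneg _)]
        congr 2; push_cast; ring
      rw [e3]
      exact s3)
  rw [integral_complex_ofReal] at key
  have inj : Function.Injective (fun k : ℕ => (k, k)) := fun x y h => (Prod.mk.inj h).1
  rw [← inj.hasSum_iff] at key
  · rw [← Complex.hasSum_ofReal]
    refine HasSum.congr_fun' key fun k => ?_
    simp only [Function.comp]
    rw [← moment_wP d hσ e he k]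
    have : ∀ w, (((bc a k : ℝ) : ℂ) * (herm z w) ^ k) *
      (((bc a k : ℝ) : ℂ) * (starRingEnd ℂ (herm z w)) ^ k) =
       ((bc a k ^ 2 * (r ^ 2) ^ k * ‖herm e w‖ ^ (2 * k) : ℝ) : ℂ) := by
      intro w
      have h1 : (herm z w) ^ k * (starRingEnd ℂ (herm z w)) ^ k =
          (((r ^ 2) ^ k * ‖herm e w‖ ^ (2 * k) : ℝ) : ℂ) := by
        rw [← mul_pow, Complex.mul_conj, Complex.normSq_eq_norm_sq, hzw, norm_mul]
        push_cast
        simp only [Complex.norm_real, Real.norm_eq_abs, abs_of_nonneg hr0]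
        rw [mul_pow, mul_pow, ← pow_mul (((‖herm e w‖ : ℝ) : ℂ))]
      push_cast at h1 ⊢
      linear_combination ((bc a k : ℝ) : ℂ) ^ 2 * h1
    simp_rw [this]
    rw [integral_complex_ofReal, integral_const_mul]
  · rintro ⟨j, k⟩ hjk
    have hjk' : j ≠ k := by
      rintro rfl; exact hjk ⟨j, rfl⟩
    have : ∀ w, (((bc a j : ℝ) : ℂ) * (herm z w) ^ j) *
      (((bc a k : ℝ) : ℂ) * (starRingEnd ℂ (herm z w)) ^ k) =
      (((bc a j : ℝ) : ℂ) * ((bc a k : ℝ) : ℂ)) *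
        ((herm z w) ^ j * (starRingEnd ℂ (herm z w)) ^ k) := by intro w; ring
    simp only [this]
    rw [integral_const_mul, offdiag d hσ z hjk', mul_zero]

/-- the ratio sequence -/
noncomputable def Rk (l m a : ℝ) (k : ℕ) : ℝ :=
  Real.Gamma (a + k) ^ 2 / (Real.Gamma (l + k) * Real.Gamma (m + k))

lemma Rk_pos {l m a : ℝ} (hl : 0 < l) (hm : 0 < m) (ha : 0 < a) (k : ℕ) : 0 < Rk l m a k := by
  have h1 := Real.Gamma_pos_of_pos (show 0 < a + k by positivity)
  have h2 := Real.Gamma_pos_of_pos (show 0 < l + k by positivity)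
  have h3 := Real.Gamma_pos_of_pos (show 0 < m + k by positivity)
  unfold Rk; positivity

lemma Rk_mono {l m a : ℝ} (hl : 0 < l) (hm : 0 < m) (ha : 2 * a = l + m) : Monotone (Rk l m a) := by
  have ha0 : 0 < a := by linarith
  refine monotone_nat_of_le_succ fun k => ?_
  have hk : (0:ℝ) ≤ k := by positivity
  have h1 := Real.Gamma_pos_of_pos (show 0 < a + k by positivity)
  have h2 := Real.Gamma_pos_of_pos (show 0 < l + k by positivity)
  have h3 := Real.Gamma_pos_of_pos (show 0 < m + k by positivity)
  have st : ∀ s : ℝ, 0 < s → Real.Gamma (s + ((k + 1 : ℕ) : ℝ)) = (s + k) * Real.Gamma (s + k) := by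
    intro s hs
    rw [show s + ((k + 1 : ℕ) : ℝ) = (s + k) + 1 by push_cast; ring, Real.Gamma_add_one (by positivity)]
  have : Rk l m a (k + 1) = Rk l m a k * ((a + k) ^ 2 / ((l + k) * (m + k))) := by
    unfold Rk
    rw [st a ha0, st l hl, st m hm]
    field_simp
  rw [this]
  refine le_mul_of_one_le_right (Rk_pos hl hm ha0 k).le ?_
  rw [one_le_div (by positivity)]
  have : a = (l + m) / 2 := by linarith
  subst this
  nlinarith [sq_nonneg (l - m)]

lemma Gamma_seq_prod {s : ℝ} (hs : 0 < s) (k : ℕ) :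
    Real.GammaSeq s k = (k : ℝ) ^ s * k.factorial * Real.Gamma s / Real.Gamma (s + (k + 1 : ℕ)) := by
  have h1 := Real.Gamma_pos_of_pos hs
  have : ∀ j : ℕ, ∏ i ∈ Finset.range j, (s + i) = Real.Gamma (s + j) / Real.Gamma s := by
    intro j
    induction j with
    | zero => simp [h1.ne']
    | succ j ih =>
      rw [Finset.prod_range_succ, ih, show s + ((j + 1 : ℕ) : ℝ) = (s + j) + 1 by push_cast; ring,
        Real.Gamma_add_one (by positivity)]
      ring
  rw [Real.GammaSeq, this]
  have h2 := Real.Gamma_pos_of_pos (show 0 < s + (k + 1 : ℕ) by positivity)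
  field_simp

lemma Rk_tendsto {l m a : ℝ} (hl : 0 < l) (hm : 0 < m) (ha : 2 * a = l + m) :
    Filter.Tendsto (Rk l m a) Filter.atTop (nhds 1) := by
  have ha0 : 0 < a := by linarith
  have g1 := Real.Gamma_pos_of_pos ha0
  have g2 := Real.Gamma_pos_of_pos hl
  have g3 := Real.Gamma_pos_of_pos hm
  rw [← Filter.tendsto_add_atTop_iff_nat 1]
  have h := (((Real.GammaSeq_tendsto_Gamma l).mul (Real.GammaSeq_tendsto_Gamma m)).div
    ((Real.GammaSeq_tendsto_Gamma a).pow 2) (by positivity)).mul_const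
      (Real.Gamma a ^ 2 / (Real.Gamma l * Real.Gamma m))
  have e1 : Real.Gamma l * Real.Gamma m / Real.Gamma a ^ 2 *
      (Real.Gamma a ^ 2 / (Real.Gamma l * Real.Gamma m)) = 1 := by field_simp
  rw [e1] at h
  refine h.congr' ?_
  filter_upwards [Filter.eventually_gt_atTop 0] with k hk
  have hk' : (0:ℝ) < k := by exact_mod_cast hk
  simp only [Pi.div_apply]
  rw [Gamma_seq_prod hl, Gamma_seq_prod hm, Gamma_seq_prod ha0, Rk]
  have h1 := Real.Gamma_pos_of_pos (show 0 < a + (k + 1 : ℕ) by positivity)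
  have h2 := Real.Gamma_pos_of_pos (show 0 < l + (k + 1 : ℕ) by positivity)
  have h3 := Real.Gamma_pos_of_pos (show 0 < m + (k + 1 : ℕ) by positivity)
  have hp : (k:ℝ) ^ l * (k:ℝ) ^ m = ((k:ℝ) ^ a) ^ 2 := by
    rw [← Real.rpow_natCast, ← Real.rpow_mul hk'.le, ← Real.rpow_add hk']
    congr 1; push_cast; linarith
  have p1 := Real.rpow_pos_of_pos hk' a
  have p2 := Real.rpow_pos_of_pos hk' l
  have p3 := Real.rpow_pos_of_pos hk' m
  have p4 : (0:ℝ) < k.factorial := by exact_mod_cast k.factorial_pos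
  field_simp
  linear_combination hp

lemma Rk_le_one {l m a : ℝ} (hl : 0 < l) (hm : 0 < m) (ha : 2 * a = l + m) (k : ℕ) :
    Rk l m a k ≤ 1 :=
  (Rk_mono hl hm ha).ge_of_tendsto (Rk_tendsto hl hm ha) k

lemma hyp_coeff {l m a : ℝ} (hl : 0 < l) (hm : 0 < m) (ha : 0 < a) (x : ℝ) (k : ℕ) :
    bc a k ^ 2 * x ^ k * (k.factorial * Real.Gamma l / Real.Gamma (l + k)) =
      (Real.Gamma l * Real.Gamma m / Real.Gamma a ^ 2) * (Rk l m a k * (bc m k * x ^ k)) := by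
  have h1 := Real.Gamma_pos_of_pos (show 0 < a + k by positivity)
  have h2 := Real.Gamma_pos_of_pos (show 0 < l + k by positivity)
  have h3 := Real.Gamma_pos_of_pos (show 0 < m + k by positivity)
  have g1 := Real.Gamma_pos_of_pos ha
  have g2 := Real.Gamma_pos_of_pos hl
  have g3 := Real.Gamma_pos_of_pos hm
  have p4 : (0:ℝ) < k.factorial := by exact_mod_cast k.factorial_pos
  unfold bc Rk
  field_simp

lemma hyp_upper (d n : ℕ) (hn : 0 < n) {σ : ℝ} (hσ : -1 < σ) (e : Cd d) (he : ‖e‖ = 1) {r : ℝ}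
    (hr0 : 0 ≤ r) (hr : r < 1) {l : ℝ} (hl : l = d + 1 + σ) :
    (1 - r ^ 2) ^ n * ∫ w, 1 / ‖1 - herm (r • e) w‖ ^ (l + n) ∂(wP d σ) ≤
      Real.Gamma l * Real.Gamma n / Real.Gamma ((l + n) / 2) ^ 2 := by
  have hd : (0:ℝ) ≤ d := by positivity
  have hl0 : 0 < l := by linarith
  have hn0 : (0:ℝ) < n := by exact_mod_cast hn
  set a : ℝ := (l + n) / 2 with ha
  have ha0 : 0 < a := by positivity
  have ha2 : 2 * a = l + n := by rw [ha]; ring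
  have h := hasSum_hyp d hσ e he hr0 hr ha0
  rw [← hl, ha2] at h
  simp_rw [hyp_coeff hl0 hn0 ha0] at h
  have hx : r ^ 2 < 1 := by nlinarith
  have h2 := hasSum_bc_real hn0 (sq_nonneg r) hx
  have g1 := Real.Gamma_pos_of_pos ha0
  have g2 := Real.Gamma_pos_of_pos hl0
  have g3 := Real.Gamma_pos_of_pos hn0
  have h3 := hasSum_le (fun k => ?_) h (h2.mul_left (Real.Gamma l * Real.Gamma n / Real.Gamma a ^ 2))
  · rw [Real.rpow_natCast] at h3
    have h4 : 0 < (1 - r ^ 2) ^ n := pow_pos (by linarith) n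
    calc _ ≤ (1 - r ^ 2) ^ n * (Real.Gamma l * Real.Gamma n / Real.Gamma a ^ 2 * (1 / (1 - r ^ 2) ^ n)) := by
          gcongr
      _ = _ := by field_simp
  · have := bc_pos hn0 k
    have h5 := Rk_le_one hl0 hn0 ha2 k
    have h6 : 0 ≤ bc n k * (r ^ 2) ^ k := by positivity
    have : Rk l n a k * (bc n k * (r ^ 2) ^ k) ≤ bc n k * (r ^ 2) ^ k := by nlinarith
    gcongr

lemma hyp_lower (d n : ℕ) (hn : 0 < n) {σ : ℝ} (hσ : -1 < σ) (e : Cd d) (he : ‖e‖ = 1) {r : ℝ}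
    (hr0 : 0 ≤ r) (hr : r < 1) {l : ℝ} (hl : l = d + 1 + σ) (K : ℕ) :
    Real.Gamma l * Real.Gamma n / Real.Gamma ((l + n) / 2) ^ 2 * (Rk l n ((l + n) / 2) K *
      (1 - (1 - r ^ 2) ^ n * ∑ k ∈ Finset.range K, bc n k)) ≤
    (1 - r ^ 2) ^ n * ∫ w, 1 / ‖1 - herm (r • e) w‖ ^ (l + n) ∂(wP d σ) := by
  have hd : (0:ℝ) ≤ d := by positivity
  have hl0 : 0 < l := by linarith
  have hn0 : (0:ℝ) < n := by exact_mod_cast hn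
  set a : ℝ := (l + n) / 2 with ha
  have ha0 : 0 < a := by positivity
  have ha2 : 2 * a = l + n := by rw [ha]; ring
  have h := hasSum_hyp d hσ e he hr0 hr ha0
  rw [← hl, ha2] at h
  simp_rw [hyp_coeff hl0 hn0 ha0] at h
  have hx : r ^ 2 < 1 := by nlinarith
  have h2 := hasSum_bc_real hn0 (sq_nonneg r) hx
  rw [Real.rpow_natCast] at h2
  have g1 := Real.Gamma_pos_of_pos ha0
  have g2 := Real.Gamma_pos_of_pos hl0
  have g3 := Real.Gamma_pos_of_pos hn0
  have h7 : HasSum (fun k => if k ∈ Finset.range K then bc n k else 0)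
      (∑ k ∈ Finset.range K, bc n k) := by
    have : HasSum (fun k => if k ∈ Finset.range K then bc n k else 0)
      (∑ k ∈ Finset.range K, if k ∈ Finset.range K then bc n k else 0) :=
      hasSum_sum_of_ne_finset_zero (fun k hk => if_neg hk)
    rwa [Finset.sum_congr rfl (fun k hk => if_pos hk)] at this
  have h3 := hasSum_le (fun k => ?_) (((h2.sub h7).mul_left (Rk l n a K)).mul_left
    (Real.Gamma l * Real.Gamma n / Real.Gamma a ^ 2)) h
  · have h4 : 0 < (1 - r ^ 2) ^ n := pow_pos (by linarith) n
    calc _ = (1 - r ^ 2) ^ n * (Real.Gamma l * Real.Gamma n / Real.Gamma a ^ 2 *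
        (Rk l n a K * (1 / (1 - r ^ 2) ^ n - ∑ k ∈ Finset.range K, bc n k))) := by field_simp
      _ ≤ _ := by gcongr
  · have hb := bc_pos hn0 k
    have hK := Rk_pos hl0 hn0 ha0 K
    have hk := Rk_pos hl0 hn0 ha0 k
    have h6 : 0 ≤ bc n k * (r ^ 2) ^ k := by positivity
    have : Rk l n a K * (bc n k * (r ^ 2) ^ k - if k ∈ Finset.range K then bc n k else 0) ≤
        Rk l n a k * (bc n k * (r ^ 2) ^ k) := by
      split_ifs with hkK
      · have : (r ^ 2) ^ k ≤ 1 := pow_le_one₀ (sq_nonneg r) hx.le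
        have : bc n k * (r ^ 2) ^ k - bc n k ≤ 0 := by nlinarith
        have : Rk l n a K * (bc n k * (r ^ 2) ^ k - bc n k) ≤ 0 :=
          mul_nonpos_of_nonneg_of_nonpos hK.le this
        have : 0 ≤ Rk l n a k * (bc n k * (r ^ 2) ^ k) := by positivity
        linarith
      · rw [sub_zero]
        have : Rk l n a K ≤ Rk l n a k := Rk_mono hl0 hn0 ha2 (by simpa using hkK)
        gcongr
    gcongr

lemma hyp_tendsto (d n : ℕ) (hn : 0 < n) {σ : ℝ} (hσ : -1 < σ) (e : Cd d) (he : ‖e‖ = 1)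
    {l : ℝ} (hl : l = d + 1 + σ) :
    Filter.Tendsto (fun r : ℝ =>
      (1 - r ^ 2) ^ n * ∫ w, 1 / ‖1 - herm (r • e) w‖ ^ (l + n) ∂(wP d σ))
      (nhdsWithin 1 (Set.Iio 1))
      (nhds (Real.Gamma l * Real.Gamma n / Real.Gamma ((l + n) / 2) ^ 2)) := by
  have hd : (0:ℝ) ≤ d := by positivity
  have hl0 : 0 < l := by linarith
  have hn0 : (0:ℝ) < n := by exact_mod_cast hn
  set L := Real.Gamma l * Real.Gamma n / Real.Gamma ((l + n) / 2) ^ 2 with hL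
  have hev : ∀ᶠ r : ℝ in nhdsWithin 1 (Set.Iio 1), 0 ≤ r ∧ r < 1 := by
    filter_upwards [self_mem_nhdsWithin, mem_nhdsWithin_of_mem_nhds (lt_mem_nhds zero_lt_one)]
      with r h1 h2
    exact ⟨h2.le, h1⟩
  rw [tendsto_order]
  constructor
  · intro b hb
    have h1 : Filter.Tendsto (fun K => L * (Rk l n ((l + n) / 2) K * 1)) Filter.atTop
        (nhds (L * (1 * 1))) :=
      ((Rk_tendsto hl0 hn0 (by ring)).mul_const 1).const_mul L
    obtain ⟨K, hK⟩ := ((tendsto_order.1 h1).1 b (by simpa using hb)).exists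
    have h2 : Filter.Tendsto (fun r : ℝ => L * (Rk l n ((l + n) / 2) K *
        (1 - (1 - r ^ 2) ^ n * ∑ k ∈ Finset.range K, bc n k))) (nhdsWithin 1 (Set.Iio 1))
        (nhds (L * (Rk l n ((l + n) / 2) K * 1))) := by
      have hc : Continuous (fun r : ℝ => L * (Rk l n ((l + n) / 2) K *
        (1 - (1 - r ^ 2) ^ n * ∑ k ∈ Finset.range K, bc n k))) := by fun_prop
      have := (hc.tendsto 1).mono_left (nhdsWithin_le_nhds (s := Set.Iio 1))
      simpa [hn.ne'] using this
    filter_upwards [(tendsto_order.1 h2).1 b hK, hev] with r h3 h4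
    exact h3.trans_le (hyp_lower d n hn hσ e he h4.1 h4.2 hl K)
  · intro b hb
    filter_upwards [hev] with r h4
    exact (hyp_upper d n hn hσ e he h4.1 h4.2 hl).trans_lt hb

/-- The basic integral operator. -/
noncomputable def Iop (d : ℕ) (σ s : ℝ) (H : Cd d → ℂ) (z : Cd d) : ℂ :=
  ∫ w, H w / (1 - herm z w) ^ (s : ℂ) ∂(wP d σ)

lemma norm_one_sub_ge {d : ℕ} {z w : Cd d} (hw : w ∈ unitBall d) :
    1 - ‖z‖ ≤ ‖1 - herm z w‖ := by
  have h1 := norm_herm_le' z hw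
  have h2 := norm_sub_norm_le 1 (herm z w)
  rw [norm_one] at h2
  linarith

lemma one_sub_mem_slit {u : ℂ} (hu : ‖u‖ < 1) : 1 - u ∈ slitPlane := by
  left
  have := Complex.re_le_norm u
  simp; linarith

lemma measurable_ker {d : ℕ} (s : ℂ) (z : Cd d) {H : Cd d → ℂ} (hH : Measurable H) :
    Measurable (fun w => H w / (1 - herm z w) ^ s) := by
  have := (continuous_herm z).measurable
  fun_prop

lemma ker_bound {d : ℕ} {s : ℝ} (hs : 0 < s) {z w : Cd d} {ε : ℝ} (hε : 0 < ε)
    (hz : ‖z‖ ≤ 1 - ε) (hw : w ∈ unitBall d) {h : ℂ} (hh : ‖h‖ ≤ 1) :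
    ‖h / (1 - herm z w) ^ (s : ℂ)‖ ≤ 1 / ε ^ s := by
  have h1 := norm_one_sub_ge (z := z) hw
  rw [norm_div, Complex.norm_cpow_real]
  have h2 : ε ≤ ‖1 - herm z w‖ := by linarith
  have h3 : ε ^ s ≤ ‖1 - herm z w‖ ^ s := Real.rpow_le_rpow hε.le h2 hs.le
  have := Real.rpow_pos_of_pos hε s
  gcongr

lemma ker_integrable (d : ℕ) (hd : 0 < d) {σ : ℝ} (hσ : -1 < σ) {s : ℝ} (hs : 0 < s)
    {H : Cd d → ℂ} (hH : Measurable H) (hH1 : ∀ w ∈ unitBall d, ‖H w‖ ≤ 1)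
    {z : Cd d} (hz : z ∈ unitBall d) :
    Integrable (fun w => H w / (1 - herm z w) ^ (s : ℂ)) (wP d σ) := by
  have := isFinite_wP d hd hσ
  have hz1 := mem_unitBall.1 hz
  refine Integrable.of_bound (measurable_ker _ z hH).aestronglyMeasurable
    (1 / (1 - ‖z‖) ^ s) ?_
  filter_upwards [ae_wP d σ] with w hw
  exact ker_bound hs (by linarith) (by linarith) hw (hH1 w hw)

lemma hasFDerivAt_ker {d : ℕ} (s : ℝ) (h : ℂ) {z w : Cd d} (hz : ‖z‖ < 1) (hw : w ∈ unitBall d) :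
    HasFDerivAt (fun z => h / (1 - herm z w) ^ (s : ℂ))
      (((s : ℂ) * (h / (1 - herm z w) ^ ((s + 1 : ℝ) : ℂ))) • innerSL ℂ w) z := by
  have hu : ‖herm z w‖ < 1 := (norm_herm_le' z hw).trans_lt hz
  have h1 : HasFDerivAt (fun z : Cd d => herm z w) (innerSL ℂ w) z := by
    have := (innerSL ℂ w).hasFDerivAt (x := z)
    refine this.congr_of_eventuallyEq (Filter.Eventually.of_forall fun x => ?_)
    exact herm_eq_inner x w
  have h2 : HasDerivAt (fun u : ℂ => h * (1 - u) ^ (-(s : ℂ)))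
      ((s : ℂ) * (h / (1 - herm z w) ^ ((s + 1 : ℝ) : ℂ))) (herm z w) := by
    have h3 : HasDerivAt (fun u : ℂ => 1 - u) (-1) (herm z w) := by
      simpa using (hasDerivAt_id (herm z w)).const_sub 1
    have h4 := (h3.cpow_const (c := -(s : ℂ)) (one_sub_mem_slit hu)).const_mul h
    have e : (s : ℂ) * (h / (1 - herm z w) ^ ((s + 1 : ℝ) : ℂ)) =
        h * (-(s : ℂ) * (1 - herm z w) ^ (-(s : ℂ) - 1) * -1) := by
      rw [show ((s + 1 : ℝ) : ℂ) = -(-(s : ℂ) - 1) by push_cast; ring, Complex.cpow_neg]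
      simp only [div_inv_eq_mul]; ring
    rw [e]; exact h4
  have h5 := h2.comp_hasFDerivAt z h1
  refine h5.congr_of_eventuallyEq (Filter.Eventually.of_forall fun x => ?_)
  simp only [Function.comp, Complex.cpow_neg, div_eq_mul_inv]

lemma hasFDerivAt_Iop (d : ℕ) (hd : 0 < d) {σ : ℝ} (hσ : -1 < σ) {s : ℝ} (hs : 0 < s)
    {H : Cd d → ℂ} (hH : Measurable H) (hH1 : ∀ w ∈ unitBall d, ‖H w‖ ≤ 1)
    {z : Cd d} (hz : z ∈ unitBall d) :
    Integrable (fun w => ((s : ℂ) * (H w / (1 - herm z w) ^ ((s + 1 : ℝ) : ℂ))) • innerSL ℂ w)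
      (wP d σ) ∧
    HasFDerivAt (Iop d σ s H)
      (∫ w, ((s : ℂ) * (H w / (1 - herm z w) ^ ((s + 1 : ℝ) : ℂ))) • innerSL ℂ w ∂(wP d σ)) z := by
  have := isFinite_wP d hd hσ
  have hz1 := mem_unitBall.1 hz
  set ε := (1 - ‖z‖) / 2 with hε
  have hε0 : 0 < ε := by linarith
  have hbd : ∀ x ∈ ball z ε, ∀ w ∈ unitBall d,
      ‖((s : ℂ) * (H w / (1 - herm x w) ^ ((s + 1 : ℝ) : ℂ))) • innerSL ℂ w‖ ≤
        s * (1 / ε ^ (s + 1)) := by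
    intro x hx w hw
    have hx1 : ‖x‖ ≤ 1 - ε := by
      have h1 : ‖x - z‖ < ε := by simpa [dist_eq_norm] using hx
      have h2 := norm_le_norm_add_norm_sub' x z
      linarith
    have h3 := ker_bound (s := s + 1) (by linarith) hε0 hx1 hw (hH1 w hw)
    have h4 := (mem_unitBall.1 hw).le
    rw [norm_smul, norm_mul, innerSL_apply_norm, Complex.norm_real, Real.norm_eq_abs,
      abs_of_pos hs]
    calc _ ≤ s * (1 / ε ^ (s + 1)) * 1 := by gcongr
      _ = _ := mul_one _
  have hmeas : ∀ x, AEStronglyMeasurable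
      (fun w => ((s : ℂ) * (H w / (1 - herm x w) ^ ((s + 1 : ℝ) : ℂ))) • innerSL ℂ w)
      (wP d σ) := by
    intro x
    have h1 := (measurable_ker ((s + 1 : ℝ) : ℂ) x hH).const_mul (s : ℂ)
    exact h1.aestronglyMeasurable.smul (innerSL ℂ).continuous.aestronglyMeasurable
  constructor
  · refine Integrable.of_bound (hmeas z) (s * (1 / ε ^ (s + 1))) ?_
    filter_upwards [ae_wP d σ] with w hw
    exact hbd z (mem_ball_self hε0) w hw
  · have A1 : ∀ᶠ x in nhds z, AEStronglyMeasurable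
        ((fun z w => H w / (1 - herm z w) ^ (s : ℂ)) x) (wP d σ) :=
      Filter.Eventually.of_forall fun x => (measurable_ker _ x hH).aestronglyMeasurable
    have A2 := ker_integrable d hd hσ hs hH hH1 hz
    have A3 : ∀ᵐ w ∂(wP d σ), ∀ x ∈ ball z ε,
        ‖(fun x w => ((s : ℂ) * (H w / (1 - herm x w) ^ ((s + 1 : ℝ) : ℂ))) • innerSL ℂ w) x w‖ ≤
          (fun _ : Cd d => s * (1 / ε ^ (s + 1))) w := by
      filter_upwards [ae_wP d σ] with w hw x hx
      exact hbd x hx w hw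
    have A4 : ∀ᵐ w ∂(wP d σ), ∀ x ∈ ball z ε,
        HasFDerivAt (fun z => (fun z w => H w / (1 - herm z w) ^ (s : ℂ)) z w)
        ((fun x w => ((s : ℂ) * (H w / (1 - herm x w) ^ ((s + 1 : ℝ) : ℂ))) • innerSL ℂ w) x w)
          x := by
      filter_upwards [ae_wP d σ] with w hw x hx
      refine hasFDerivAt_ker s (H w) ?_ hw
      have h1 : ‖x - z‖ < ε := by simpa [dist_eq_norm] using hx
      have h2 := norm_le_norm_add_norm_sub' x z
      linarith
    have := hasFDerivAt_integral_of_dominated_of_fderiv_le (𝕜 := ℂ) (μ := wP d σ)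
      (F := fun z w => H w / (1 - herm z w) ^ (s : ℂ))
      (F' := fun x w => ((s : ℂ) * (H w / (1 - herm x w) ^ ((s + 1 : ℝ) : ℂ))) • innerSL ℂ w)
      (bound := fun _ => s * (1 / ε ^ (s + 1))) (ball_mem_nhds z hε0)
      A1 A2 (hmeas z) A3 (integrable_const _) A4
    exact this

lemma pd_Iop (d : ℕ) (hd : 0 < d) {σ : ℝ} (hσ : -1 < σ) {s : ℝ} (hs : 0 < s)
    {H : Cd d → ℂ} (hH : Measurable H) (hH1 : ∀ w ∈ unitBall d, ‖H w‖ ≤ 1)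
    {z : Cd d} (hz : z ∈ unitBall d) (j : Fin d) :
    pd d j (Iop d σ s H) z =
      s * Iop d σ (s + 1) (fun w => starRingEnd ℂ (w j) * H w) z := by
  obtain ⟨h1, h2⟩ := hasFDerivAt_Iop d hd hσ hs hH hH1 hz
  rw [pd, h2.fderiv, ContinuousLinearMap.integral_apply h1, Iop, ← integral_const_mul]
  congr 1; ext w
  simp [EuclideanSpace.inner_single_right]
  ring

lemma pd_congr {d : ℕ} (j : Fin d) {f g : Cd d → ℂ} (h : ∀ z ∈ unitBall d, f z = g z)
    {z : Cd d} (hz : z ∈ unitBall d) : pd d j f z = pd d j g z := by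
  have : f =ᶠ[nhds z] g := by
    filter_upwards [isOpen_ball.mem_nhds hz] with x hx using h x hx
  rw [pd, pd, this.fderiv_eq]

lemma pd_cIop (d : ℕ) (hd : 0 < d) {σ : ℝ} (hσ : -1 < σ) {s : ℝ} (hs : 0 < s) (c : ℂ)
    {H : Cd d → ℂ} (hH : Measurable H) (hH1 : ∀ w ∈ unitBall d, ‖H w‖ ≤ 1)
    {z : Cd d} (hz : z ∈ unitBall d) (j : Fin d) :
    pd d j (fun z => c * Iop d σ s H z) z =
      c * s * Iop d σ (s + 1) (fun w => starRingEnd ℂ (w j) * H w) z := by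
  obtain ⟨h1, h2⟩ := hasFDerivAt_Iop d hd hσ hs hH hH1 hz
  have h3 := pd_Iop d hd hσ hs hH hH1 hz j
  have h4 := (h2.const_mul c).fderiv
  rw [pd, h4, ← h2.fderiv]
  rw [pd] at h3
  simp only [_root_.smul_apply, smul_eq_mul, h3]
  ring

lemma norm_coord_le {d : ℕ} {w : Cd d} (hw : w ∈ unitBall d) (j : Fin d) : ‖w j‖ ≤ 1 :=
  (PiLp.norm_apply_le w j).trans (mem_unitBall.1 hw).le

lemma pd_iter (d : ℕ) (hd : 0 < d) {σ : ℝ} (hσ : -1 < σ) {s : ℝ} (hs : 0 < s) (c : ℂ)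
    {H : Cd d → ℂ} (hH : Measurable H) (hH1 : ∀ w ∈ unitBall d, ‖H w‖ ≤ 1)
    {f : Cd d → ℂ} (hf : ∀ z ∈ unitBall d, f z = c * Iop d σ s H z)
    (j : Fin d) (k : ℕ) : ∀ z ∈ unitBall d,
    (pd d j)^[k] f z = c * (Real.Gamma (s + k) / Real.Gamma s : ℝ) *
        Iop d σ (s + k) (fun w => starRingEnd ℂ (w j) ^ k * H w) z := by
  induction k with
  | zero =>
    intro z hz
    have := (Real.Gamma_pos_of_pos hs).ne'
    simp [hf z hz, div_self this]
  | succ k ih =>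
    intro z hz
    rw [Function.iterate_succ_apply', pd_congr j ih hz]
    have hm : Measurable (fun w : Cd d => starRingEnd ℂ (w j) ^ k * H w) := by
      have : Measurable (fun w : Cd d => starRingEnd ℂ (w j)) := by
        have : Continuous (fun w : Cd d => starRingEnd ℂ (w j)) := by fun_prop
        exact this.measurable
      fun_prop
    rw [pd_cIop d hd hσ (by positivity) _ hm ?_ hz j]
    · have e : Real.Gamma (s + (k + 1 : ℕ)) = (s + k) * Real.Gamma (s + k) := by
        rw [← Real.Gamma_add_one (by positivity)]; push_cast; ring_nf
      rw [e]
      have e2 : s + (k + 1 : ℕ) = s + k + 1 := by push_cast; ring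
      have e3 : (fun w : Cd d => starRingEnd ℂ (w j) * (starRingEnd ℂ (w j) ^ k * H w)) =
        (fun w : Cd d => starRingEnd ℂ (w j) ^ (k + 1) * H w) := by
        ext w; ring
      rw [e2, e3]; push_cast; ring
    · intro w hw
      have h1 := norm_coord_le hw j
      rw [norm_mul, norm_pow, RCLike.norm_conj]
      exact mul_le_one₀ (pow_le_one₀ (norm_nonneg _) h1) (norm_nonneg _) (hH1 w hw)

lemma mpd_list (d : ℕ) (hd : 0 < d) {σ : ℝ} (hσ : -1 < σ) {s : ℝ} (hs : 0 < s)
    {G : Cd d → ℂ} (hG : Measurable G) (hG1 : ∀ w, ‖G w‖ ≤ 1)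
    {f : Cd d → ℂ} (hf : ∀ z ∈ unitBall d, f z = Iop d σ s G z) (α : Fin d → ℕ)
    (L : List (Fin d)) :
    Measurable (fun w : Cd d => (L.map (fun j => starRingEnd ℂ (w j) ^ α j)).prod * G w) ∧
    (∀ w ∈ unitBall d, ‖(L.map (fun j => starRingEnd ℂ (w j) ^ α j)).prod * G w‖ ≤ 1) ∧
    ∀ z ∈ unitBall d, L.foldr (fun j g => (pd d j)^[α j] g) f z =
      (Real.Gamma (s + (L.map α).sum) / Real.Gamma s : ℝ) *
      Iop d σ (s + (L.map α).sum)
        (fun w => (L.map (fun j => starRingEnd ℂ (w j) ^ α j)).prod * G w) z := by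
  induction L with
  | nil =>
    refine ⟨by simpa using hG, by simpa using fun w _ => hG1 w, fun z hz => ?_⟩
    have := (Real.Gamma_pos_of_pos hs).ne'
    simp [hf z hz, div_self this]
  | cons j L ih =>
    obtain ⟨i1, i2, i3⟩ := ih
    have e0 : ∀ w : Cd d, ((j :: L).map (fun j => starRingEnd ℂ (w j) ^ α j)).prod * G w =
        starRingEnd ℂ (w j) ^ α j * ((L.map (fun j => starRingEnd ℂ (w j) ^ α j)).prod * G w) := by
      intro w; simp [mul_assoc]
    simp only [e0]
    refine ⟨?_, ?_, ?_⟩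
    · have : Measurable (fun w : Cd d => starRingEnd ℂ (w j)) := by
        have : Continuous (fun w : Cd d => starRingEnd ℂ (w j)) := by fun_prop
        exact this.measurable
      exact (this.pow_const _).mul i1
    · intro w hw
      rw [norm_mul, norm_pow, RCLike.norm_conj]
      exact mul_le_one₀ (pow_le_one₀ (norm_nonneg _) (norm_coord_le hw j)) (norm_nonneg _) (i2 w hw)
    · intro z hz
      rw [List.foldr_cons, pd_iter d hd hσ (by positivity) _ i1 i2 i3 j (α j) z hz]
      have e1 : s + (((j :: L).map α).sum : ℕ) = s + ((L.map α).sum : ℕ) + α j := by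
        simp; ring
      rw [e1]
      have g1 := (Real.Gamma_pos_of_pos (show 0 < s + ((L.map α).sum : ℕ) by positivity)).ne'
      have e2 : (Real.Gamma (s + ((L.map α).sum : ℕ) + α j) / Real.Gamma s : ℝ) =
        (Real.Gamma (s + ((L.map α).sum : ℕ)) / Real.Gamma s : ℝ) *
        (Real.Gamma (s + ((L.map α).sum : ℕ) + α j) / Real.Gamma (s + ((L.map α).sum : ℕ)) : ℝ) := by
        field_simp
      rw [e2, Complex.ofReal_mul]

lemma mpd_bergman (d n : ℕ) (hd : 0 < d) {σ : ℝ} (hσ : -1 < σ) {l : ℝ} (hl : l = d + 1 + σ)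
    {G : Cd d → ℂ} (hG : Measurable G) (hG1 : ∀ w, ‖G w‖ ≤ 1) (α : MIdx d n)
    {z : Cd d} (hz : z ∈ unitBall d) :
    mpd d α.1 (bergman d σ G) z = (Real.Gamma (l + n) / Real.Gamma l : ℝ) *
      Iop d σ (l + n) (fun w => starRingEnd ℂ (Zmap d n w α) * G w) z := by
  have hd' : (0:ℝ) ≤ d := by positivity
  have hl0 : 0 < l := by linarith
  have h := (mpd_list d hd hσ hl0 hG hG1 (f := bergman d σ G)
    (fun z hz => by rw [bergman_eq d hσ, hl]; rfl) α.1 (List.finRange d)).2.2 z hz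
  rw [mpd, h]
  have e1 : ((List.finRange d).map α.1).sum = n := by
    have := α.2
    rw [Fin.sum_univ_def] at this
    exact this
  rw [e1]
  have e2 : ∀ w : Cd d, ((List.finRange d).map (fun j => starRingEnd ℂ (w j) ^ α.1 j)).prod =
      starRingEnd ℂ (Zmap d n w α) := by
    intro w
    rw [← Fin.prod_univ_def, Zmap, map_prod]; simp
  simp only [e2]

/-- The `ℓ^p` expression on finitely many coordinates. -/
noncomputable def LN {ι : Type*} [Fintype ι] (p : ℝ) (W : ι → ℂ) : ℝ :=
  (∑ i, ‖W i‖ ^ p) ^ (1 / p)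

lemma LN_nonneg {ι : Type*} [Fintype ι] (p : ℝ) (W : ι → ℂ) : 0 ≤ LN p W := by
  unfold LN; positivity

lemma LN_mono {ι : Type*} [Fintype ι] {p : ℝ} (hp : 1 ≤ p) {W V : ι → ℂ}
    (h : ∀ i, ‖W i‖ ≤ ‖V i‖) : LN p W ≤ LN p V := by
  unfold LN
  gcongr with i
  exact h i

lemma LN_smul {ι : Type*} [Fintype ι] {p : ℝ} (hp : 1 ≤ p) (c : ℂ) (W : ι → ℂ) :
    LN p (fun i => c * W i) = ‖c‖ * LN p W := by
  unfold LN
  simp_rw [norm_mul, Real.mul_rpow (norm_nonneg _) (norm_nonneg _), ← Finset.mul_sum]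
  rw [Real.mul_rpow (by positivity) (by positivity), ← Real.rpow_mul (norm_nonneg _),
    mul_one_div_cancel (by linarith), Real.rpow_one]

lemma LN_congr_norm {ι : Type*} [Fintype ι] {p : ℝ} {W V : ι → ℂ}
    (h : ∀ i, ‖W i‖ = ‖V i‖) : LN p W = LN p V := by
  unfold LN
  simp_rw [h]

lemma LN_integral_le {ι : Type*} [Fintype ι] {Ω : Type*} [MeasurableSpace Ω] {μ : Measure Ω}
    {p : ℝ} (hp : 1 ≤ p) {f : Ω → ι → ℂ} (hf : ∀ i, Integrable (fun w => f w i) μ) :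
    LN p (fun i => ∫ w, f w i ∂μ) ≤ ∫ w, LN p (f w) ∂μ := by
  have hp0 : (ENNReal.ofReal p).toReal = p := ENNReal.toReal_ofReal (by linarith)
  haveI : Fact (1 ≤ ENNReal.ofReal p) := ⟨by simpa using ENNReal.ofReal_le_ofReal hp⟩
  have key : ∀ W : PiLp (ENNReal.ofReal p) (fun _ : ι => ℂ), ‖W‖ = LN p (fun i => W i) := by
    intro W
    rw [PiLp.norm_eq_sum (by rw [hp0]; linarith), hp0, LN]
  have h1 := norm_integral_le_integral_norm (μ := μ)
    (fun w => (WithLp.toLp (ENNReal.ofReal p) (f w) : PiLp (ENNReal.ofReal p) (fun _ : ι => ℂ)))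
  simp_rw [key] at h1
  have h2 : ∀ i, (∫ w, (WithLp.toLp (ENNReal.ofReal p) (f w) :
      PiLp (ENNReal.ofReal p) (fun _ : ι => ℂ)) ∂μ) i = ∫ w, f w i ∂μ := fun i =>
    eval_integral_piLp (f := fun w => (WithLp.toLp (ENNReal.ofReal p) (f w) :
      PiLp (ENNReal.ofReal p) (fun _ : ι => ℂ))) hf i
  simp_rw [h2] at h1
  exact h1

lemma Zmap_smul (d n : ℕ) (c : ℂ) (ζ : Cd d) (α : MIdx d n) :
    Zmap d n (c • ζ) α = c ^ n * Zmap d n ζ α := by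
  have h := α.2
  simp only [Zmap, PiLp.smul_apply, smul_eq_mul, mul_pow, Finset.prod_mul_distrib,
    Finset.prod_pow_eq_pow_sum]
  congr 2

lemma exists_dir (d : ℕ) (hd : 0 < d) (z : Cd d) : ∃ e : Cd d, ‖e‖ = 1 ∧ z = ‖z‖ • e := by
  by_cases hz : z = 0
  · obtain ⟨e, he⟩ := exists_unit d hd
    exact ⟨e, he, by simp [hz]⟩
  · have h : ‖z‖ ≠ 0 := norm_ne_zero_iff.2 hz
    refine ⟨‖z‖⁻¹ • z, ?_, ?_⟩
    · rw [norm_smul, norm_inv, norm_norm, inv_mul_cancel₀ h]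
    · rw [smul_smul, mul_inv_cancel₀ h, one_smul]

lemma Zmap_norm_le (d n : ℕ) {ζ : Cd d} (h : ‖ζ‖ ≤ 1) (α : MIdx d n) : ‖Zmap d n ζ α‖ ≤ 1 := by
  rw [Zmap, norm_prod]
  refine Finset.prod_le_one (fun _ _ => norm_nonneg _) fun j _ => ?_
  rw [norm_pow]
  exact pow_le_one₀ (norm_nonneg _) ((PiLp.norm_apply_le ζ j).trans h)

lemma bdd_sphere (d n : ℕ) {p : ℝ} (hp : 1 ≤ p) :
    BddAbove (Set.range fun ζ : Metric.sphere (0 : Cd d) 1 => LN p (Zmap d n (ζ : Cd d))) := by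
  refine ⟨LN p (fun _ : MIdx d n => (1 : ℂ)), ?_⟩
  rintro _ ⟨ζ, rfl⟩
  refine LN_mono hp fun α => ?_
  have := Zmap_norm_le d n (ζ := ζ) (by simpa using ζ.2.le) α
  simpa using this

lemma LN_Zmap_le (d n : ℕ) (hd : 0 < d) {p : ℝ} (hp : 1 ≤ p) {w : Cd d} (hw : ‖w‖ ≤ 1) :
    LN p (Zmap d n w) ≤
      ⨆ ζ : Metric.sphere (0 : Cd d) 1, LN p (Zmap d n (ζ : Cd d)) := by
  obtain ⟨e, he, hwe⟩ := exists_dir d hd w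
  have h1 : LN p (Zmap d n w) = ‖w‖ ^ n * LN p (Zmap d n e) := by
    have : Zmap d n w = fun α => ((‖w‖ : ℝ) : ℂ) ^ n * Zmap d n e α := by
      ext α
      rw [← Zmap_smul]
      conv_lhs => rw [hwe]
      rfl
    rw [this, LN_smul hp]
    simp
  have h2 := le_ciSup (bdd_sphere d n hp) ⟨e, by simpa using he⟩
  rw [h1]
  refine le_trans ?_ h2
  exact mul_le_of_le_one_left (LN_nonneg _ _) (pow_le_one₀ (norm_nonneg _) hw)

lemma conjZ_meas (d n : ℕ) (α : MIdx d n) {G : Cd d → ℂ} (hG : Measurable G) :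
    Measurable (fun w => starRingEnd ℂ (Zmap d n w α) * G w) := by
  have : Continuous (fun w : Cd d => starRingEnd ℂ (Zmap d n w α)) := by
    unfold Zmap; fun_prop
  exact this.measurable.mul hG

lemma conjZ_le (d n : ℕ) (α : MIdx d n) {G : Cd d → ℂ} (hG1 : ∀ w, ‖G w‖ ≤ 1) :
    ∀ w ∈ unitBall d, ‖starRingEnd ℂ (Zmap d n w α) * G w‖ ≤ 1 := by
  intro w hw
  rw [norm_mul, RCLike.norm_conj]
  exact mul_le_one₀ (Zmap_norm_le d n (mem_unitBall.1 hw).le α) (norm_nonneg _) (hG1 w)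

lemma upper_bound (d n : ℕ) (hd : 0 < d) (hn : 0 < n) {σ : ℝ} (hσ : -1 < σ) {l : ℝ}
    (hl : l = d + 1 + σ) {p : ℝ} (hp : 1 ≤ p)
    {G : Cd d → ℂ} (hG : Measurable G) (hG1 : ∀ w, ‖G w‖ ≤ 1)
    {z : Cd d} (hz : z ∈ unitBall d) :
    (1 - ‖z‖ ^ 2) ^ n * LN p (fun α : MIdx d n => mpd d α.1 (bergman d σ G) z) ≤
      (⨆ ζ : Metric.sphere (0 : Cd d) 1, LN p (Zmap d n (ζ : Cd d))) *
        (Real.Gamma (l + n) * Real.Gamma n / Real.Gamma ((l + n) / 2) ^ 2) := by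
  have hd' : (0:ℝ) ≤ d := by positivity
  have hl0 : 0 < l := by linarith
  have hn0 : (0:ℝ) < n := by exact_mod_cast hn
  have hz1 := mem_unitBall.1 hz
  have g2 := Real.Gamma_pos_of_pos hl0
  have g3 := Real.Gamma_pos_of_pos (show 0 < l + n by positivity)
  set C := ⨆ ζ : Metric.sphere (0 : Cd d) 1, LN p (Zmap d n (ζ : Cd d)) with hC
  have hC0 : 0 ≤ C := Real.iSup_nonneg fun _ => LN_nonneg _ _
  simp_rw [mpd_bergman d n hd hσ hl hG hG1 _ hz]
  rw [LN_smul hp, Complex.norm_real, Real.norm_eq_abs, abs_of_pos (by positivity)]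
  have hint : ∀ α : MIdx d n, Integrable
      (fun w => starRingEnd ℂ (Zmap d n w α) * G w / (1 - herm z w) ^ ((l + n : ℝ) : ℂ)) (wP d σ) :=
    fun α => ker_integrable d hd hσ (by positivity) (conjZ_meas d n α hG) (conjZ_le d n α hG1) hz
  have hint1 : Integrable (fun w => 1 / ‖1 - herm z w‖ ^ (l + n)) (wP d σ) := by
    have := (ker_integrable d hd hσ (s := l + n) (by positivity) (H := fun _ => 1)
      measurable_const (fun _ _ => by simp) hz).norm
    simpa only [norm_div, Complex.norm_cpow_real, norm_one] using this
  have h1 : LN p (fun α : MIdx d n =>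
      Iop d σ (l + n) (fun w => starRingEnd ℂ (Zmap d n w α) * G w) z) ≤
      C * ∫ w, 1 / ‖1 - herm z w‖ ^ (l + n) ∂(wP d σ) := by
    refine (LN_integral_le hp hint).trans ?_
    rw [← integral_const_mul]
    refine integral_mono_of_nonneg (Filter.Eventually.of_forall fun w => LN_nonneg _ _)
      (hint1.const_mul C) ?_
    filter_upwards [ae_wP d σ] with w hw
    have e1 : LN p (fun α : MIdx d n =>
        starRingEnd ℂ (Zmap d n w α) * G w / (1 - herm z w) ^ ((l + n : ℝ) : ℂ)) =
        ‖G w‖ / ‖1 - herm z w‖ ^ (l + n) * LN p (Zmap d n w) := by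
      have := LN_smul hp (G w / (1 - herm z w) ^ ((l + n : ℝ) : ℂ)) (Zmap d n w)
      rw [norm_div, Complex.norm_cpow_real] at this
      rw [← this]
      refine LN_congr_norm fun α => ?_
      simp only [norm_mul, norm_div, RCLike.norm_conj]
      ring
    change LN p (fun α : MIdx d n =>
        starRingEnd ℂ (Zmap d n w α) * G w / (1 - herm z w) ^ ((l + n : ℝ) : ℂ)) ≤ _
    rw [e1, mul_comm]
    have h3 := LN_Zmap_le d n hd hp (mem_unitBall.1 hw).le
    have h4 := LN_nonneg p (Zmap d n w)
    have h5 := hG1 w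
    gcongr
  obtain ⟨e, he, hze⟩ := exists_dir d hd z
  have h2 := hyp_upper d n hn hσ e he (norm_nonneg z) hz1 hl
  rw [← hze] at h2
  have h3 : 0 ≤ (1 - ‖z‖ ^ 2) ^ n := pow_nonneg (by nlinarith [norm_nonneg z]) n
  calc _ ≤ (1 - ‖z‖ ^ 2) ^ n * (Real.Gamma (l + n) / Real.Gamma l *
        (C * ∫ w, 1 / ‖1 - herm z w‖ ^ (l + n) ∂(wP d σ))) := by gcongr
    _ = C * (Real.Gamma (l + n) / Real.Gamma l) * ((1 - ‖z‖ ^ 2) ^ n *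
        ∫ w, 1 / ‖1 - herm z w‖ ^ (l + n) ∂(wP d σ)) := by ring
    _ ≤ C * (Real.Gamma (l + n) / Real.Gamma l) *
        (Real.Gamma l * Real.Gamma n / Real.Gamma ((l + n) / 2) ^ 2) := by gcongr
    _ = _ := by field_simp

lemma herm_rsmul {d : ℕ} (r : ℝ) (z w : Cd d) : herm (r • z) w = r * herm z w := by
  simp [herm, Finset.mul_sum, mul_assoc]

lemma dist_sq_le {d : ℕ} {e w : Cd d} (he : ‖e‖ = 1) (hw : ‖w‖ < 1) {r : ℝ} (hr0 : 0 ≤ r)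
    (hr : r < 1) : ‖w - e‖ ^ 2 ≤ 4 * ‖1 - herm (r • e) w‖ := by
  have h1 : ‖w - e‖ ^ 2 ≤ 2 * ‖1 - herm e w‖ := by
    have h2 := norm_sub_sq (𝕜 := ℂ) w e
    rw [← herm_eq_inner, he] at h2
    have h3 := Complex.re_le_norm (1 - herm e w)
    have h4 : (1 - herm e w).re = 1 - (herm e w).re := by simp
    have h5 : RCLike.re (herm e w) = (herm e w).re := rfl
    rw [h5] at h2
    nlinarith [norm_nonneg w]
  have h2 : ‖herm e w‖ ≤ 1 := by
    have := norm_herm_le' e (mem_unitBall.2 hw); rwa [he] at this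
  rw [herm_rsmul]
  set u := herm e w
  have h3 : ‖1 - u‖ ≤ ‖1 - r * u‖ + ‖((1 - r : ℝ) : ℂ) * u‖ := by
    have : 1 - u = (1 - r * u) - ((1 - r : ℝ) : ℂ) * u := by push_cast; ring
    rw [this]; exact norm_sub_le _ _
  have h4 : ‖((1 - r : ℝ) : ℂ) * u‖ ≤ 1 - r := by
    rw [norm_mul, Complex.norm_real, Real.norm_eq_abs, abs_of_pos (by linarith)]
    exact mul_le_of_le_one_right (by linarith) h2
  have h5 : 1 - r ≤ ‖1 - r * u‖ := by
    have h6 := norm_sub_norm_le 1 (r * u)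
    rw [norm_one, norm_mul, Complex.norm_real, Real.norm_eq_abs, abs_of_nonneg hr0] at h6
    nlinarith
  linarith

lemma inv_integrable (d : ℕ) (hd : 0 < d) {σ : ℝ} (hσ : -1 < σ) {s : ℝ} (hs : 0 < s)
    {z : Cd d} (hz : z ∈ unitBall d) :
    Integrable (fun w => 1 / ‖1 - herm z w‖ ^ s) (wP d σ) := by
  have := (ker_integrable d hd hσ (s := s) hs (H := fun _ => 1)
    measurable_const (fun _ _ => by simp) hz).norm
  simpa only [norm_div, Complex.norm_cpow_real, norm_one] using this

lemma rsmul_mem {d : ℕ} {e : Cd d} (he : ‖e‖ = 1) {r : ℝ} (hr0 : 0 ≤ r) (hr : r < 1) :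
    r • e ∈ unitBall d := by
  rw [mem_unitBall, norm_smul, he, Real.norm_eq_abs, abs_of_nonneg hr0]; linarith

lemma ev_Iio : ∀ᶠ r : ℝ in nhdsWithin 1 (Set.Iio 1), 0 ≤ r ∧ r < 1 := by
  filter_upwards [self_mem_nhdsWithin, mem_nhdsWithin_of_mem_nhds (lt_mem_nhds zero_lt_one)]
    with r h1 h2
  exact ⟨h2.le, h1⟩

lemma pow_tendsto_zero (n : ℕ) (hn : 0 < n) (K : ℝ) :
    Filter.Tendsto (fun r : ℝ => (1 - r ^ 2) ^ n * K) (nhdsWithin 1 (Set.Iio 1)) (nhds 0) := by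
  have hc : Continuous (fun r : ℝ => (1 - r ^ 2) ^ n * K) := by fun_prop
  have := (hc.tendsto 1).mono_left (nhdsWithin_le_nhds (s := Set.Iio 1))
  simpa [hn.ne'] using this

lemma concentrate (d n : ℕ) (hd : 0 < d) (hn : 0 < n) {σ : ℝ} (hσ : -1 < σ) {l : ℝ}
    (hl : l = d + 1 + σ) {e : Cd d} (he : ‖e‖ = 1) {φ : Cd d → ℂ} (hφ : Continuous φ)
    (hφ0 : φ e = 0) {M : ℝ} (hM : ∀ w ∈ unitBall d, ‖φ w‖ ≤ M) :
    Filter.Tendsto (fun r : ℝ => (((1 - r ^ 2) ^ n : ℝ) : ℂ) *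
      ∫ w, φ w / ((‖1 - herm (r • e) w‖ ^ (l + n) : ℝ) : ℂ) ∂(wP d σ))
      (nhdsWithin 1 (Set.Iio 1)) (nhds 0) := by
  have hd' : (0:ℝ) ≤ d := by positivity
  have hl0 : 0 < l := by linarith
  have hs : 0 < l + n := by positivity
  have hfin := isFinite_wP d hd hσ
  have hM0 : 0 ≤ M := (norm_nonneg _).trans (hM 0 (by simp [mem_unitBall]))
  set L0 := Real.Gamma l * Real.Gamma n / Real.Gamma ((l + n) / 2) ^ 2 with hL0
  have hL : 0 ≤ L0 := by
    have hn0 : (0:ℝ) < n := by exact_mod_cast hn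
    have g1 := Real.Gamma_pos_of_pos hl0
    have g2 := Real.Gamma_pos_of_pos hn0
    positivity
  rw [Metric.tendsto_nhds]
  intro ε hε
  set η := ε / (2 * (L0 + 1)) with hη
  have hη0 : 0 < η := by positivity
  obtain ⟨δ, hδ0, hδ⟩ := Metric.continuous_iff.1 hφ e η hη0
  have hb : ∀ r : ℝ, 0 ≤ r → r < 1 → ∀ w ∈ unitBall d,
      ‖φ w / ((‖1 - herm (r • e) w‖ ^ (l + n) : ℝ) : ℂ)‖ ≤
        η * (1 / ‖1 - herm (r • e) w‖ ^ (l + n)) + M * (4 / δ ^ 2) ^ (l + n) := by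
    intro r hr0 hr w hw
    have h1 : 0 ≤ ‖1 - herm (r • e) w‖ ^ (l + n) := by positivity
    rw [norm_div, Complex.norm_real, Real.norm_eq_abs, abs_of_nonneg h1]
    by_cases hwe : dist w e < δ
    · have h2 := hδ w hwe
      rw [hφ0, dist_zero_right] at h2
      have h3 : ‖φ w‖ / ‖1 - herm (r • e) w‖ ^ (l + n) ≤ η * (1 / ‖1 - herm (r • e) w‖ ^ (l + n)) := by
        rw [mul_one_div]; gcongr
      have : 0 ≤ M * (4 / δ ^ 2) ^ (l + n) := by positivity
      linarith
    · have h2 := dist_sq_le he (mem_unitBall.1 hw) hr0 hr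
      rw [dist_eq_norm, not_lt] at hwe
      have h4 : δ ^ 2 / 4 ≤ ‖1 - herm (r • e) w‖ := by nlinarith
      have h5 : ‖φ w‖ / ‖1 - herm (r • e) w‖ ^ (l + n) ≤ M * (4 / δ ^ 2) ^ (l + n) := by
        have h6 : (δ ^ 2 / 4) ^ (l + n) ≤ ‖1 - herm (r • e) w‖ ^ (l + n) :=
          Real.rpow_le_rpow (by positivity) h4 hs.le
        have h7 : (4 / δ ^ 2) ^ (l + n) = 1 / (δ ^ 2 / 4) ^ (l + n) := by
          rw [one_div, ← Real.inv_rpow (by positivity), inv_div]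
        rw [h7, mul_one_div]
        have := hM w hw
        gcongr
      have : 0 ≤ η * (1 / ‖1 - herm (r • e) w‖ ^ (l + n)) := by positivity
      linarith
  set K := M * (4 / δ ^ 2) ^ (l + n) * (wP d σ).real Set.univ with hK
  have hev2 := (tendsto_order.1 (pow_tendsto_zero n hn K)).2 (ε / 2) (by positivity)
  filter_upwards [ev_Iio, hev2] with r hr hr2
  obtain ⟨hr0, hr1⟩ := hr
  have hp : 0 ≤ (1 - r ^ 2) ^ n := pow_nonneg (by nlinarith) n
  have hi := inv_integrable d hd hσ hs (rsmul_mem he hr0 hr1)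
  have h1 : ‖∫ w, φ w / ((‖1 - herm (r • e) w‖ ^ (l + n) : ℝ) : ℂ) ∂(wP d σ)‖ ≤
      η * (∫ w, 1 / ‖1 - herm (r • e) w‖ ^ (l + n) ∂(wP d σ)) + K := by
    have := norm_integral_le_of_norm_le ((hi.const_mul η).add
      (integrable_const (M * (4 / δ ^ 2) ^ (l + n))))
      (by filter_upwards [ae_wP d σ] with w hw using hb r hr0 hr1 w hw)
    refine this.trans (le_of_eq ?_)
    simp only [Pi.add_apply]
    rw [integral_add (hi.const_mul η) (integrable_const _), integral_const_mul, integral_const,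
      smul_eq_mul, hK]
    ring
  rw [dist_zero_right, norm_mul, Complex.norm_real, Real.norm_eq_abs, abs_of_nonneg hp]
  have h2 := hyp_upper d n hn hσ e he hr0 hr1 hl
  calc _ ≤ (1 - r ^ 2) ^ n * (η * (∫ w, 1 / ‖1 - herm (r • e) w‖ ^ (l + n) ∂(wP d σ)) + K) := by
        gcongr
    _ = η * ((1 - r ^ 2) ^ n * ∫ w, 1 / ‖1 - herm (r • e) w‖ ^ (l + n) ∂(wP d σ)) +
        (1 - r ^ 2) ^ n * K := by ring
    _ ≤ η * L0 + (1 - r ^ 2) ^ n * K := by gcongr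
    _ < η * L0 + ε / 2 := by linarith
    _ ≤ ε := by
      have : η * (L0 + 1) = ε / 2 := by rw [hη]; field_simp
      nlinarith

/-- The extremal function. -/
noncomputable def Gext (d : ℕ) (s : ℝ) (z : Cd d) (w : Cd d) : ℂ :=
  (1 - herm z w) ^ (s : ℂ) / ((‖(1 - herm z w) ^ (s : ℂ)‖ : ℝ) : ℂ)

lemma Gext_meas (d : ℕ) (s : ℝ) (z : Cd d) : Measurable (Gext d s z) := by
  have := (continuous_herm z).measurable
  unfold Gext
  fun_prop

lemma Gext_le (d : ℕ) (s : ℝ) (z w : Cd d) : ‖Gext d s z w‖ ≤ 1 := by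
  unfold Gext
  rw [norm_div, Complex.norm_real, norm_norm]
  exact div_self_le_one _

lemma Iop_Gext (d : ℕ) {σ : ℝ} (s : ℝ) {z : Cd d} (hz : z ∈ unitBall d) (H : Cd d → ℂ) :
    Iop d σ s (fun w => H w * Gext d s z w) z =
      ∫ w, H w / ((‖1 - herm z w‖ ^ s : ℝ) : ℂ) ∂(wP d σ) := by
  unfold Iop
  refine integral_congr_ae ?_
  filter_upwards [ae_wP d σ] with w hw
  have h1 := norm_one_sub_ge (z := z) hw
  have hz1 := mem_unitBall.1 hz
  have h2 : 1 - herm z w ≠ 0 := by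
    intro h; rw [h, norm_zero] at h1; linarith
  have h3 : (1 - herm z w) ^ (s : ℂ) ≠ 0 := by
    simp [Complex.cpow_eq_zero_iff, h2]
  unfold Gext
  rw [← Complex.norm_cpow_real]
  have h4 : ((‖(1 - herm z w) ^ (s : ℂ)‖ : ℝ) : ℂ) ≠ 0 := 
    Complex.ofReal_ne_zero.2 (norm_ne_zero_iff.2 h3)
  field_simp

lemma ext_tendsto (d n : ℕ) (hd : 0 < d) (hn : 0 < n) {σ : ℝ} (hσ : -1 < σ) {l : ℝ}
    (hl : l = d + 1 + σ) {e : Cd d} (he : ‖e‖ = 1) (α : MIdx d n) :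
    Filter.Tendsto (fun r : ℝ => (((1 - r ^ 2) ^ n : ℝ) : ℂ) *
      mpd d α.1 (bergman d σ (Gext d (l + n) (r • e))) (r • e))
      (nhdsWithin 1 (Set.Iio 1))
      (nhds (((Real.Gamma (l + n) * Real.Gamma n / Real.Gamma ((l + n) / 2) ^ 2 : ℝ) : ℂ) *
        starRingEnd ℂ (Zmap d n e α))) := by
  have hd' : (0:ℝ) ≤ d := by positivity
  have hl0 : 0 < l := by linarith
  have hs : 0 < l + n := by positivity
  have hfin := isFinite_wP d hd hσ
  have hcont : Continuous (fun w : Cd d => starRingEnd ℂ (Zmap d n w α)) := by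
    unfold Zmap; fun_prop
  have h1 := concentrate d n hd hn hσ hl he (φ := fun w => starRingEnd ℂ (Zmap d n w α) -
    starRingEnd ℂ (Zmap d n e α)) (hcont.sub continuous_const) (sub_self _) (M := 2) (by
      intro w hw
      refine (norm_sub_le _ _).trans ?_
      rw [RCLike.norm_conj, RCLike.norm_conj]
      have a1 := Zmap_norm_le d n (mem_unitBall.1 hw).le α
      have a2 := Zmap_norm_le d n he.le α
      linarith)
  have h2 := (Complex.continuous_ofReal.tendsto _).comp (hyp_tendsto d n hn hσ e he hl)
  have h3 := (h1.add (h2.const_mul (starRingEnd ℂ (Zmap d n e α)))).const_mul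
    ((Real.Gamma (l + n) / Real.Gamma l : ℝ) : ℂ)
  have g1 := (Real.Gamma_pos_of_pos hl0).ne'
  have e1 : ((Real.Gamma (l + n) / Real.Gamma l : ℝ) : ℂ) * (0 + starRingEnd ℂ (Zmap d n e α) *
      ((Real.Gamma l * Real.Gamma n / Real.Gamma ((l + n) / 2) ^ 2 : ℝ) : ℂ)) =
      ((Real.Gamma (l + n) * Real.Gamma n / Real.Gamma ((l + n) / 2) ^ 2 : ℝ) : ℂ) *
        starRingEnd ℂ (Zmap d n e α) := by
    have : (Real.Gamma (l + n) * Real.Gamma n / Real.Gamma ((l + n) / 2) ^ 2 : ℝ) =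
      (Real.Gamma (l + n) / Real.Gamma l : ℝ) *
      (Real.Gamma l * Real.Gamma n / Real.Gamma ((l + n) / 2) ^ 2 : ℝ) := by field_simp
    rw [this, Complex.ofReal_mul]; ring
  rw [e1] at h3
  refine h3.congr' ?_
  filter_upwards [ev_Iio] with r hr
  have hz := rsmul_mem he hr.1 hr.2
  rw [mpd_bergman d n hd hσ hl (Gext_meas d _ _) (Gext_le d _ _) α hz, Iop_Gext d _ hz]
  have hi := inv_integrable d hd hσ hs hz
  have hi2 : Integrable (fun w => starRingEnd ℂ (Zmap d n e α) *
      ((1 / ‖1 - herm (r • e) w‖ ^ (l + n) : ℝ) : ℂ)) (wP d σ) := hi.ofReal.const_mul _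
  have hi3 : Integrable (fun w => starRingEnd ℂ (Zmap d n w α) /
      ((‖1 - herm (r • e) w‖ ^ (l + n) : ℝ) : ℂ)) (wP d σ) := by
    refine Integrable.mono' hi ?_ ?_
    · have := (continuous_herm (r • e)).measurable
      have := hcont.measurable
      refine Measurable.aestronglyMeasurable ?_
      fun_prop
    · filter_upwards [ae_wP d σ] with w hw
      have h1 : 0 ≤ ‖1 - herm (r • e) w‖ ^ (l + n) := by positivity
      rw [norm_div, Complex.norm_real, Real.norm_eq_abs, abs_of_nonneg h1, RCLike.norm_conj]
      have := Zmap_norm_le d n (mem_unitBall.1 hw).le α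
      gcongr
  have e2 : (∫ w, (starRingEnd ℂ (Zmap d n w α) - starRingEnd ℂ (Zmap d n e α)) /
      ((‖1 - herm (r • e) w‖ ^ (l + n) : ℝ) : ℂ) ∂(wP d σ)) =
      (∫ w, starRingEnd ℂ (Zmap d n w α) /
      ((‖1 - herm (r • e) w‖ ^ (l + n) : ℝ) : ℂ) ∂(wP d σ)) - starRingEnd ℂ (Zmap d n e α) *
      ((∫ w, 1 / ‖1 - herm (r • e) w‖ ^ (l + n) ∂(wP d σ) : ℝ) : ℂ) := by
    rw [← integral_complex_ofReal, ← integral_const_mul, ← integral_sub hi3 hi2]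
    congr 1; ext w
    push_cast; ring
  simp only [Function.comp]
  rw [e2]
  push_cast; ring

lemma LN_continuous {ι : Type*} [Fintype ι] {p : ℝ} (hp : 1 ≤ p) :
    Continuous (fun W : ι → ℂ => LN p W) := by
  unfold LN
  refine Continuous.rpow_const (continuous_finsetSum _ fun i _ => ?_)
    (fun _ => Or.inr (by positivity))
  exact Continuous.rpow_const (by fun_prop) (fun _ => Or.inr (by linarith))

lemma lower_bound (d n : ℕ) (hd : 0 < d) (hn : 0 < n) {σ : ℝ} (hσ : -1 < σ) {l : ℝ}
    (hl : l = d + 1 + σ) {p : ℝ} (hp : 1 ≤ p) {B : ℝ}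
    (hB : ∀ G : Cd d → ℂ, Measurable G → (∀ w, ‖G w‖ ≤ 1) → ∀ z ∈ unitBall d,
      (1 - ‖z‖ ^ 2) ^ n * LN p (fun α : MIdx d n => mpd d α.1 (bergman d σ G) z) ≤ B)
    {e : Cd d} (he : ‖e‖ = 1) :
    LN p (Zmap d n e) * (Real.Gamma (l + n) * Real.Gamma n / Real.Gamma ((l + n) / 2) ^ 2) ≤ B := by
  have hd' : (0:ℝ) ≤ d := by positivity
  have hl0 : 0 < l := by linarith
  have hn0 : (0:ℝ) < n := by exact_mod_cast hn
  set c := Real.Gamma (l + n) * Real.Gamma n / Real.Gamma ((l + n) / 2) ^ 2 with hc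
  have hc0 : 0 ≤ c := by
    have g1 := Real.Gamma_pos_of_pos (show 0 < l + n by positivity)
    have g2 := Real.Gamma_pos_of_pos hn0
    positivity
  have h1 := tendsto_pi_nhds.2 fun α : MIdx d n => ext_tendsto d n hd hn hσ hl he α
  have h2 := ((LN_continuous hp).tendsto _).comp h1
  have e1 : LN p (fun α : MIdx d n => (c : ℂ) * starRingEnd ℂ (Zmap d n e α)) =
      LN p (Zmap d n e) * c := by
    rw [LN_smul hp, Complex.norm_real, Real.norm_eq_abs, abs_of_nonneg hc0, mul_comm]
    congr 1
    exact LN_congr_norm fun i => RCLike.norm_conj _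
  rw [← e1]
  refine le_of_tendsto h2 ?_
  filter_upwards [ev_Iio] with r hr
  have hz := rsmul_mem he hr.1 hr.2
  have h3 := hB _ (Gext_meas d (l + n) (r • e)) (Gext_le d _ _) _ hz
  have e2 : ‖r • e‖ = r := by
    rw [norm_smul, he, Real.norm_eq_abs, abs_of_nonneg hr.1, mul_one]
  have hp0 : 0 ≤ (1 - r ^ 2) ^ n := pow_nonneg (by nlinarith [hr.1, hr.2]) n
  rw [e2] at h3
  refine le_trans (le_of_eq ?_) h3
  simp only [Function.comp]
  rw [LN_smul hp, Complex.norm_real, Real.norm_eq_abs, abs_of_nonneg hp0]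

lemma card_MIdx (d n : ℕ) (hd : 0 < d) :
    Fintype.card (MIdx d n) = Nat.choose (n + d - 1) (d - 1) := by
  have h1 : Fintype.card (Sym (Fin d) n) = Fintype.card (MIdx d n) :=
    Fintype.card_congr (Sym.equivNatSumOfFintype (Fin d) n)
  rw [← h1, Sym.card_sym_eq_choose, Fintype.card_fin, add_comm d n]
  exact Nat.choose_symm_of_eq_add (by omega)

lemma sum_Z_sq_le (d n : ℕ) {ζ : Cd d} (hζ : ‖ζ‖ = 1) :
    ∑ α : MIdx d n, ‖Zmap d n ζ α‖ ^ (2 : ℝ) ≤ 1 := by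
  have h1 : ∑ j, ‖ζ j‖ ^ 2 = 1 := by
    rw [← EuclideanSpace.norm_sq_eq, hζ]; norm_num
  have h2 := Finset.sum_pow_eq_sum_piAntidiag Finset.univ (fun j => ‖ζ j‖ ^ 2) n
  rw [h1, one_pow] at h2
  have h3 : ∑ α : MIdx d n, ‖Zmap d n ζ α‖ ^ (2 : ℝ) =
      ∑ k ∈ Finset.piAntidiag Finset.univ n, ∏ j, (‖ζ j‖ ^ 2) ^ k j := by
    have h4 := Finset.sum_subtype (p := fun α : Fin d → ℕ => ∑ j, α j = n)
      (F := inferInstanceAs (Fintype (MIdx d n)))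
      (Finset.piAntidiag Finset.univ n) (by intro x; simp)
      (fun k => ∏ j, (‖ζ j‖ ^ 2) ^ k j)
    rw [h4]
    refine Finset.sum_congr rfl fun α _ => ?_
    rw [Real.rpow_two, Zmap, norm_prod, ← Finset.prod_pow]
    refine Finset.prod_congr rfl fun j _ => ?_
    rw [norm_pow, ← pow_mul, ← pow_mul, mul_comm]
  rw [h3, h2]
  refine Finset.sum_le_sum fun k _ => ?_
  have h5 : (1:ℝ) ≤ Nat.multinomial Finset.univ k := by
    exact_mod_cast Nat.multinomial_pos (s := Finset.univ) (f := k)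
  exact le_mul_of_one_le_left (Finset.prod_nonneg fun j _ => by positivity) h5

lemma LN_le_two (d n : ℕ) {p : ℝ} (hp : 2 ≤ p) {ζ : Cd d} (hζ : ‖ζ‖ = 1) :
    LN p (Zmap d n ζ) ≤ 1 := by
  unfold LN
  refine Real.rpow_le_one (by positivity) ?_ (by positivity)
  refine le_trans (Finset.sum_le_sum fun α _ => ?_) (sum_Z_sq_le d n hζ)
  rcases (norm_nonneg (Zmap d n ζ α)).eq_or_lt with h | h
  · rw [← h, Real.zero_rpow (by linarith), Real.zero_rpow (by norm_num)]
  · exact Real.rpow_le_rpow_of_exponent_ge h (Zmap_norm_le d n hζ.le α) hp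

lemma LN_ge_one (d n : ℕ) (hd : 0 < d) {p : ℝ} (hp : 1 ≤ p) :
    ∃ ζ : Cd d, ‖ζ‖ = 1 ∧ 1 ≤ LN p (Zmap d n ζ) := by
  let j0 : Fin d := ⟨0, hd⟩
  refine ⟨EuclideanSpace.single j0 1, by simp, ?_⟩
  let α0 : MIdx d n := ⟨fun j => if j = j0 then n else 0, by simp⟩
  have h1 : Zmap d n (EuclideanSpace.single j0 1) α0 = 1 := by
    refine Finset.prod_eq_one fun j _ => ?_
    by_cases hj : j = j0
    · subst hj; simp
    · have : α0.1 j = 0 := if_neg hj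
      rw [this, pow_zero]
  unfold LN
  refine Real.one_le_rpow ?_ (by positivity)
  have h2 := Finset.single_le_sum (f := fun α : MIdx d n =>
    ‖Zmap d n (EuclideanSpace.single j0 1) α‖ ^ p) (fun _ _ => by positivity) (Finset.mem_univ α0)
  simpa [h1] using h2

lemma LN_upper (d n : ℕ) (hd : 0 < d) {p : ℝ} (hp : 1 ≤ p) (hp2 : p < 2) {ζ : Cd d}
    (hζ : ‖ζ‖ = 1) :
    LN p (Zmap d n ζ) ≤ (Nat.choose (n + d - 1) (d - 1) : ℝ) ^ (1 / p - 1 / 2) := by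
  have hp0 : 0 < p := by linarith
  have h1 := Real.rpow_sum_le_const_mul_sum_rpow_of_nonneg (Finset.univ : Finset (MIdx d n))
    (f := fun α => ‖Zmap d n ζ α‖ ^ p) (p := 2 / p) ((one_le_div hp0).2 hp2.le)
    (fun _ _ => by positivity)
  simp_rw [← Real.rpow_mul (norm_nonneg _), mul_div_cancel₀ _ hp0.ne'] at h1
  rw [Finset.card_univ, card_MIdx d n hd] at h1
  set D : ℝ := (Nat.choose (n + d - 1) (d - 1) : ℝ) with hD
  have hD0 : 0 ≤ D := by positivity
  have h2 : (∑ α : MIdx d n, ‖Zmap d n ζ α‖ ^ p) ^ (2 / p) ≤ D ^ (2 / p - 1) := by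
    refine h1.trans ?_
    exact mul_le_of_le_one_right (by positivity) (sum_Z_sq_le d n hζ)
  have h3 := Real.rpow_le_rpow (by positivity) h2 (show (0:ℝ) ≤ 1 / 2 by norm_num)
  rw [← Real.rpow_mul (by positivity), ← Real.rpow_mul hD0] at h3
  unfold LN
  convert h3 using 2 <;> field_simp

lemma LN_lower (d n : ℕ) (hd : 0 < d) {p : ℝ} (hp : 1 ≤ p) :
    ∃ ζ : Cd d, ‖ζ‖ = 1 ∧ LN p (Zmap d n ζ) =
      (Nat.choose (n + d - 1) (d - 1) : ℝ) ^ (1 / p) * (d : ℝ) ^ (-(n : ℝ) / 2) := by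
  have hd0 : (0:ℝ) < d := by exact_mod_cast hd
  have hp0 : 0 < p := by linarith
  set t : ℝ := (d : ℝ) ^ (-(1 : ℝ) / 2) with ht
  have ht0 : 0 ≤ t := by positivity
  have ht2 : t ^ 2 = (d : ℝ)⁻¹ := by
    rw [ht, ← Real.rpow_natCast, ← Real.rpow_mul hd0.le, ← Real.rpow_neg_one]; norm_num
  have htn : t ^ n = (d : ℝ) ^ (-(n : ℝ) / 2) := by
    rw [ht, ← Real.rpow_natCast, ← Real.rpow_mul hd0.le]; congr 1; ring
  let ζ : Cd d := WithLp.toLp 2 (fun _ => (t : ℂ))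
  refine ⟨ζ, ?_, ?_⟩
  · have : ‖ζ‖ ^ 2 = 1 := by
      rw [EuclideanSpace.norm_sq_eq]
      simp only [ζ, Complex.norm_real, Real.norm_eq_abs, sq_abs, ht2]
      simp [hd0.ne']
    have h := norm_nonneg ζ
    nlinarith
  · have h1 : ∀ α : MIdx d n, ‖Zmap d n ζ α‖ = t ^ n := by
      intro α
      have h := α.2
      simp only [Zmap, ζ, Finset.prod_pow_eq_pow_sum, norm_pow, Complex.norm_real,
        Real.norm_eq_abs, abs_of_nonneg ht0]
      congr 1
    unfold LN
    simp_rw [h1]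
    rw [Finset.sum_const, Finset.card_univ, card_MIdx d n hd, nsmul_eq_mul,
      Real.mul_rpow (by positivity) (by positivity), ← Real.rpow_mul (by positivity),
      mul_one_div_cancel hp0.ne', Real.rpow_one, htn]

/-- With the Bloch seminorm `‖f‖_𝓑 = sup_{z∈B} (1-|z|²)^n (∑_{|α|=n} |∂^α f(z)|^p)^{1/p}`,
`‖T_σ‖_{L^∞(B)→𝓑} = C_p · Γ(λ+n)Γ(n)/Γ((λ+n)/2)²` where `C_p = max_{|ζ|=1} |Z(ζ)|_p`
satisfies `d̃^{1/p} d^{-n/2} ≤ C_p ≤ d̃^{1/p-1/2}` for `1 ≤ p < 2` and `C_p = 1` for `2 ≤ p`. -/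
theorem bergman_projection_seminorm_lp
    (d n : ℕ) (hd : 0 < d) (hn : 0 < n) (σ : ℝ) (hσ : -1 < σ)
    (lam : ℝ) (hlam : lam = d + 1 + σ) (p : ℝ) (hp : 1 ≤ p)
    (Cp : ℝ)
    (hCp : Cp = ⨆ ζ : Metric.sphere (0 : Cd d) 1,
        (∑ α : MIdx d n, ‖Zmap d n (ζ : Cd d) α‖ ^ p) ^ (1 / p)) :
    (⨆ G : {G : Cd d → ℂ // Measurable G ∧ ∀ w, ‖G w‖ ≤ 1},
        ⨆ z : unitBall d,
          (1 - ‖(z : Cd d)‖ ^ 2) ^ n *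
            (∑ α : MIdx d n, ‖mpd d α.1 (bergman d σ G.1) (z : Cd d)‖ ^ p) ^ (1 / p)) =
      Cp * (Real.Gamma (lam + n) * Real.Gamma n / Real.Gamma ((lam + n) / 2) ^ 2) ∧
    (p < 2 →
      ((Nat.choose (n + d - 1) (d - 1) : ℝ) ^ (1 / p) * (d : ℝ) ^ (-(n : ℝ) / 2) ≤ Cp ∧
        Cp ≤ (Nat.choose (n + d - 1) (d - 1) : ℝ) ^ (1 / p - 1 / 2))) ∧
    (2 ≤ p → Cp = 1) := by
  subst hCp
  have hne : Nonempty (Metric.sphere (0 : Cd d) 1) := by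
    obtain ⟨e, he⟩ := exists_unit d hd
    exact ⟨⟨e, by simpa using he⟩⟩
  have hbdd := bdd_sphere d n hp
  have hsph : ∀ ζ : Metric.sphere (0 : Cd d) 1, ‖(ζ : Cd d)‖ = 1 := fun ζ => by simp
  have hle : ∀ ζ : Cd d, ‖ζ‖ = 1 → LN p (Zmap d n ζ) ≤
      ⨆ ζ : Metric.sphere (0 : Cd d) 1, LN p (Zmap d n (ζ : Cd d)) :=
    fun ζ hζ => le_ciSup hbdd ⟨ζ, by simpa using hζ⟩
  have hub := fun (G : Cd d → ℂ) (hG : Measurable G) (hG1 : ∀ w, ‖G w‖ ≤ 1) (z : Cd d)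
    (hz : z ∈ unitBall d) => upper_bound d n hd hn hσ hlam hp hG hG1 hz
  have hd' : (0:ℝ) ≤ d := by positivity
  have hl0 : 0 < lam := by linarith
  have hn0 : (0:ℝ) < n := by exact_mod_cast hn
  have hc0 : 0 < Real.Gamma (lam + n) * Real.Gamma n / Real.Gamma ((lam + n) / 2) ^ 2 := by
    have g1 := Real.Gamma_pos_of_pos (show 0 < lam + n by positivity)
    have g2 := Real.Gamma_pos_of_pos hn0
    have g3 := Real.Gamma_pos_of_pos (show 0 < (lam + n) / 2 by positivity)
    positivity
  have hneG : Nonempty {G : Cd d → ℂ // Measurable G ∧ ∀ w, ‖G w‖ ≤ 1} :=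
    ⟨⟨fun _ => 0, measurable_const, fun _ => by simp⟩⟩
  have hneB : Nonempty (unitBall d) := ⟨⟨0, by simp [mem_unitBall]⟩⟩
  refine ⟨le_antisymm ?_ ?_, fun hp2 => ⟨?_, ?_⟩, fun hp2 => le_antisymm ?_ ?_⟩
  · exact ciSup_le fun G => ciSup_le fun z => hub G.1 G.2.1 G.2.2 z z.2
  · rw [← le_div_iff₀ hc0]
    refine ciSup_le fun ζ => ?_
    rw [le_div_iff₀ hc0]
    refine lower_bound d n hd hn hσ hlam hp (fun G hG hG1 z hz => ?_) (hsph ζ)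
    have b1 : ∀ G : {G : Cd d → ℂ // Measurable G ∧ ∀ w, ‖G w‖ ≤ 1},
        BddAbove (Set.range fun z : unitBall d => (1 - ‖(z : Cd d)‖ ^ 2) ^ n *
          LN p (fun α : MIdx d n => mpd d α.1 (bergman d σ G.1) (z : Cd d))) := by
      intro G
      refine ⟨(⨆ ζ : Metric.sphere (0 : Cd d) 1, LN p (Zmap d n (ζ : Cd d))) *
        (Real.Gamma (lam + n) * Real.Gamma n / Real.Gamma ((lam + n) / 2) ^ 2), ?_⟩
      · rintro _ ⟨z, rfl⟩
        exact hub G.1 G.2.1 G.2.2 z z.2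
    have b2 : BddAbove (Set.range fun G : {G : Cd d → ℂ // Measurable G ∧ ∀ w, ‖G w‖ ≤ 1} =>
        ⨆ z : unitBall d, (1 - ‖(z : Cd d)‖ ^ 2) ^ n *
          LN p (fun α : MIdx d n => mpd d α.1 (bergman d σ G.1) (z : Cd d))) := by
      refine ⟨(⨆ ζ : Metric.sphere (0 : Cd d) 1, LN p (Zmap d n (ζ : Cd d))) *
        (Real.Gamma (lam + n) * Real.Gamma n / Real.Gamma ((lam + n) / 2) ^ 2), ?_⟩
      · rintro _ ⟨G, rfl⟩
        exact ciSup_le fun z => hub G.1 G.2.1 G.2.2 z z.2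
    exact (le_ciSup (b1 ⟨G, hG, hG1⟩) ⟨z, hz⟩).trans (le_ciSup b2 ⟨G, hG, hG1⟩)
  · obtain ⟨ζ, h1, h2⟩ := LN_lower d n hd hp
    rw [← h2]
    exact hle ζ h1
  · exact ciSup_le fun ζ => LN_upper d n hd hp hp2 (hsph ζ)
  · exact ciSup_le fun ζ => LN_le_two d n hp2 (hsph ζ)
  · obtain ⟨ζ, h1, h2⟩ := LN_ge_one d n hd hp
    exact h2.trans (hle ζ h1)
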